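/- arXiv:1611.02455 — 2 statements merged into one kernel-verified Lean document; each statement's English description precedes it below -/
import Mathlib

section
/- Let P ⊂ ℝ^d be a minimal canonical Fano polytope of dimension d that is not a simplex. Then there exists an integer k with 1 ≤ k < d and a minimal canonical Fano k-simplex S (with respect to the lattice lin(S) ∩ ℤ^d) contained in P with vert(S) ⊆ vert(P). Moreover, for any such S there exist an integer s with 0 ≤ s < k and a minimal canonical Fano polytope P' of dimension d − k + s (with respect to the lattice lin(P') ∩ ℤ^d) with vert(P') ⊆ vert(P), such that P = conv(S ∪ P') and s = |vert(S) ∩ vert(P')|. -/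
open MeasureTheory Set
open scoped ENNReal

/-- The Sylvester sequence, 0-indexed: `sylvester 0 = 2 = s₁`,
`sylvester (n+1) = (sylvester n)^2 - sylvester n + 1`, so that `sₙ = sylvester (n-1)`. -/
def sylvester : ℕ → ℕ
  | 0 => 2
  | n + 1 => (sylvester n) ^ 2 - sylvester n + 1

/-- A point of `ℝ^d` is a lattice point if all its coordinates are integers. -/
def IsLatticePt {d : ℕ} (x : Fin d → ℝ) : Prop := ∀ i, ∃ z : ℤ, x i = (z : ℝ)

/-- A lattice polytope: the convex hull of finitely many lattice points. -/
def IsLatticePolytope {d : ℕ} (P : Set (Fin d → ℝ)) : Prop :=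
  ∃ V : Finset (Fin d → ℝ), (∀ v ∈ V, IsLatticePt v) ∧ P = convexHull ℝ (V : Set (Fin d → ℝ))

/-- A canonical Fano polytope in `ℝ^d`: a lattice polytope (automatically of full
dimension `d`) whose interior contains exactly one lattice point, namely the origin. -/
def IsCanonicalFano {d : ℕ} (P : Set (Fin d → ℝ)) : Prop :=
  IsLatticePolytope P ∧ {x ∈ interior P | IsLatticePt x} = {0}

/-- The dual (polar) of a set `P ⊆ ℝ^d`: all `y` with `⟨y, x⟩ ≥ -1` for every `x ∈ P`. -/
def polarDual {d : ℕ} (P : Set (Fin d → ℝ)) : Set (Fin d → ℝ) :=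
  {y | ∀ x ∈ P, -1 ≤ ∑ i, y i * x i}

/-- A simplex of dimension `k` in `ℝ^d`: the convex hull of `k + 1` affinely
independent points. -/
def IsSimplexOfDim {d : ℕ} (k : ℕ) (S : Set (Fin d → ℝ)) : Prop :=
  ∃ f : Fin (k + 1) → (Fin d → ℝ), AffineIndependent ℝ f ∧ S = convexHull ℝ (Set.range f)

/-- A canonical Fano polytope of dimension `k` with respect to the lattice
`lin(S) ∩ ℤ^d`: a lattice polytope of dimension `k` whose relative interior contains
exactly one lattice point, namely the origin. -/
def IsCanonicalFanoOfDim {d : ℕ} (k : ℕ) (S : Set (Fin d → ℝ)) : Prop :=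
  IsLatticePolytope S ∧ Module.finrank ℝ ↥(vectorSpan ℝ S) = k ∧
    {x ∈ intrinsicInterior ℝ S | IsLatticePt x} = {0}

/-- Minimality for canonical Fano polytopes of dimension `k` (w.r.t. `lin(S) ∩ ℤ^d`):
removing any vertex destroys the property. -/
def IsMinimalCanonicalFanoOfDim {d : ℕ} (k : ℕ) (S : Set (Fin d → ℝ)) : Prop :=
  IsCanonicalFanoOfDim k S ∧ ∀ v ∈ Set.extremePoints ℝ S,
    ¬ IsCanonicalFanoOfDim k (convexHull ℝ ({x ∈ S | IsLatticePt x} \ {v}))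

/-- A minimal (full-dimensional) canonical Fano polytope in `ℝ^d`: removing any vertex
destroys the property of being a `d`-dimensional canonical Fano polytope. -/
def IsMinimalCanonicalFano {d : ℕ} (P : Set (Fin d → ℝ)) : Prop :=
  IsCanonicalFano P ∧ ∀ v ∈ Set.extremePoints ℝ P,
    ¬ IsCanonicalFano (convexHull ℝ ({x ∈ P | IsLatticePt x} \ {v}))

section Cone

variable {E : Type*} [AddCommGroup E] [Module ℝ E]

/-- The convex cone of nonnegative combinations of elements of a set is a submodule
over the nonnegative reals. -/
abbrev nnCone (X : Set E) : Submodule NNReal E := Submodule.span NNReal X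

lemma smul_mem_nnCone {X : Set E} {x : E} (hx : x ∈ nnCone X) {t : ℝ} (ht : 0 ≤ t) :
    t • x ∈ nnCone X :=
  (nnCone X).smul_mem (⟨t, ht⟩ : NNReal) hx

lemma nnCone_subset_span (X : Set E) {x : E} (hx : x ∈ nnCone X) : x ∈ Submodule.span ℝ X := by
  have h : nnCone X ≤ (Submodule.span ℝ X).restrictScalars NNReal :=
    Submodule.span_le.2 Submodule.subset_span
  exact h hx

lemma mem_nnCone_of_mem_span {X Y : Set E} (hX : X ⊆ nnCone Y) (hN : ∀ x ∈ X, -x ∈ nnCone Y)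
    {y : E} (hy : y ∈ Submodule.span ℝ X) : y ∈ nnCone Y := by
  suffices h : y ∈ nnCone Y ∧ -y ∈ nnCone Y from h.1
  induction hy using Submodule.span_induction with
  | mem x hx => exact ⟨hX hx, hN x hx⟩
  | zero => simp
  | add x y _ _ hx hy =>
    rw [neg_add]
    exact ⟨add_mem hx.1 hy.1, add_mem hx.2 hy.2⟩
  | smul a x _ hx =>
    rcases le_total 0 a with ha | ha
    · exact ⟨smul_mem_nnCone hx.1 ha, by simpa using smul_mem_nnCone hx.2 ha⟩
    · have ha' : 0 ≤ -a := by linarith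
      exact ⟨by simpa using smul_mem_nnCone hx.2 ha', by simpa using smul_mem_nnCone hx.1 ha'⟩

lemma convexHull_subset_nnCone (X : Set E) : convexHull ℝ X ⊆ nnCone X := by
  refine convexHull_min Submodule.subset_span ?_
  intro x hx y hy a b ha hb _
  exact add_mem (smul_mem_nnCone hx ha) (smul_mem_nnCone hy hb)

lemma exists_smul_of_mem_nnCone {X : Set E} (hX : X.Nonempty) {y : E} (hy : y ∈ nnCone X) :
    ∃ t : ℝ, 0 ≤ t ∧ ∃ c ∈ convexHull ℝ X, y = t • c := by
  induction hy using Submodule.span_induction with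
  | mem x hx => exact ⟨1, zero_le_one, x, subset_convexHull ℝ X hx, (one_smul ℝ x).symm⟩
  | zero =>
    obtain ⟨x, hx⟩ := hX
    exact ⟨0, le_rfl, x, subset_convexHull ℝ X hx, (zero_smul ℝ x).symm⟩
  | add x y _ _ hx hy =>
    obtain ⟨s, hs, c, hc, rfl⟩ := hx
    obtain ⟨t, ht, e, he, rfl⟩ := hy
    obtain ⟨z, hz, h⟩ := (convex_convexHull ℝ X).exists_mem_add_smul_eq hc he hs ht
    exact ⟨s + t, add_nonneg hs ht, z, hz, h.symm⟩
  | smul a x _ hx =>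
    obtain ⟨t, ht, c, hc, rfl⟩ := hx
    exact ⟨a * t, mul_nonneg a.2 ht, c, hc, by rw [mul_smul]; rfl⟩

lemma zero_mem_convexHull_of_neg_mem_nnCone {X : Set E} (hX : X.Nonempty)
    (hN : ∀ x ∈ X, -x ∈ nnCone X) : (0 : E) ∈ convexHull ℝ X := by
  obtain ⟨x, hx⟩ := hX
  obtain ⟨t, ht, c, hc, h⟩ := exists_smul_of_mem_nnCone ⟨x, hx⟩ (hN x hx)
  have h1 : (0 : E) = (1 / (1 + t)) • x + (t / (1 + t)) • c := by
    rw [div_eq_inv_mul, div_eq_inv_mul, mul_smul, mul_smul, ← smul_add, ← h]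
    simp
  rw [h1]
  refine convex_convexHull ℝ X (subset_convexHull ℝ X hx) hc (by positivity) (by positivity) ?_
  field_simp

lemma neg_mem_nnCone_of_pos_relation {X : Set E} {T : Finset E} {w : E → ℝ}
    (hw : ∀ t ∈ T, 0 < w t) (hTX : (T : Set E) ⊆ X)
    (h : -(∑ t ∈ T, w t • t) ∈ nnCone X) : ∀ t ∈ T, -t ∈ nnCone X := by
  classical
  intro t ht
  have h1 : -t = (w t)⁻¹ • (-(∑ t ∈ T, w t • t) + ∑ s ∈ T.erase t, w s • s) := by
    rw [← Finset.add_sum_erase T _ ht, neg_add, neg_add_cancel_right, smul_neg,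
      inv_smul_smul₀ (hw t ht).ne']
  rw [h1]
  refine smul_mem_nnCone (add_mem h (sum_mem fun s hs => ?_)) (inv_nonneg.2 (hw t ht).le)
  exact smul_mem_nnCone (Submodule.subset_span (hTX (Finset.mem_of_mem_erase hs)))
    (hw s (Finset.mem_of_mem_erase hs)).le

lemma exists_pos_relation {U : Finset E} (hN : ∀ u ∈ U, -u ∈ nnCone (U : Set E)) :
    ∃ c : E → ℝ, (∀ u, 0 < c u) ∧ ∑ u ∈ U, c u • u = 0 := by
  have h : -(∑ u ∈ U, u) ∈ nnCone (U : Set E) := by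
    rw [← Finset.sum_neg_distrib]
    exact sum_mem hN
  obtain ⟨f, -, hf⟩ := Submodule.mem_span_finset.1 h
  refine ⟨fun u => 1 + f u, fun u => by positivity, ?_⟩
  simp only [add_smul, one_smul, Finset.sum_add_distrib]
  have : ∑ u ∈ U, (f u : ℝ) • u = -(∑ u ∈ U, u) := hf
  rw [this, add_neg_cancel]

end Cone

section RelInterior

variable {E : Type*} [NormedAddCommGroup E] [NormedSpace ℝ E]

lemma affineSpan_eq_span_of_zero_mem {C : Set E} (h0 : (0 : E) ∈ C) :
    affineSpan ℝ C = (Submodule.span ℝ C).toAffineSubspace := by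
  refine SetLike.coe_injective ?_
  have h := affineSpan_insert_zero (k := ℝ) C
  rwa [insert_eq_of_mem h0] at h

lemma vectorSpan_eq_span_of_zero_mem {C : Set E} (h0 : (0 : E) ∈ C) :
    vectorSpan ℝ C = Submodule.span ℝ C := by
  rw [← direction_affineSpan, affineSpan_eq_span_of_zero_mem h0]
  exact Submodule.toAffineSubspace_direction _

lemma intrinsicInterior_eq_image_span {C : Set E} (h0 : (0 : E) ∈ C) :
    intrinsicInterior ℝ C =
      (↑) '' interior ((↑) ⁻¹' C : Set (Submodule.span ℝ C)) := by
  have key : ∀ A : AffineSubspace ℝ E, A = affineSpan ℝ C →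
      intrinsicInterior ℝ C = (↑) '' interior ((↑) ⁻¹' C : Set A) := by
    rintro _ rfl
    rfl
  exact key _ (affineSpan_eq_span_of_zero_mem h0).symm

lemma exists_add_smul_mem_of_mem_intrinsicInterior {C : Set E} (h0 : (0 : E) ∈ C) {x y : E}
    (hx : x ∈ intrinsicInterior ℝ C) (hy : y ∈ Submodule.span ℝ C) :
    ∃ ε : ℝ, 0 < ε ∧ x + ε • y ∈ C := by
  rw [intrinsicInterior_eq_image_span h0] at hx
  obtain ⟨x, hx, rfl⟩ := hx
  have hc : Continuous fun t : ℝ => x + t • (⟨y, hy⟩ : Submodule.span ℝ C) := by fun_prop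
  have h1 : ∀ᶠ t in nhds (0 : ℝ), x + t • (⟨y, hy⟩ : Submodule.span ℝ C) ∈
      ((↑) ⁻¹' C : Set (Submodule.span ℝ C)) := by
    refine hc.continuousAt.eventually_mem ?_
    simpa using mem_interior_iff_mem_nhds.1 hx
  obtain ⟨ε, hε, h⟩ := Metric.eventually_nhds_iff.1 h1
  refine ⟨ε / 2, by positivity, ?_⟩
  have := h (y := ε / 2) (by rw [Real.dist_eq, sub_zero, abs_of_pos] <;> linarith)
  simpa using this

lemma span_convexHull (X : Set E) : Submodule.span ℝ (convexHull ℝ X) = Submodule.span ℝ X :=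
  le_antisymm (Submodule.span_le.2 fun _ hx => nnCone_subset_span X (convexHull_subset_nnCone X hx))
    (Submodule.span_mono (subset_convexHull ℝ X))

lemma neg_mem_nnCone_of_zero_mem_intrinsicInterior {X : Set E}
    (h0 : (0 : E) ∈ intrinsicInterior ℝ (convexHull ℝ X)) : ∀ x ∈ X, -x ∈ nnCone X := by
  intro x hx
  obtain ⟨ε, hε, h⟩ := exists_add_smul_mem_of_mem_intrinsicInterior
    (intrinsicInterior_subset h0) h0 (y := -x)
    (neg_mem (Submodule.subset_span (subset_convexHull ℝ X hx)))
  have h1 := smul_mem_nnCone (convexHull_subset_nnCone X h) (inv_nonneg.2 hε.le)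
  rwa [zero_add, inv_smul_smul₀ hε.ne'] at h1

lemma zero_mem_intrinsicInterior_of_neg_mem_nnCone [FiniteDimensional ℝ E] {X : Set E}
    (hX : X.Nonempty) (hN : ∀ x ∈ X, -x ∈ nnCone X) :
    (0 : E) ∈ intrinsicInterior ℝ (convexHull ℝ X) := by
  have h0 := zero_mem_convexHull_of_neg_mem_nnCone hX hN
  obtain ⟨y, hy⟩ := Set.Nonempty.intrinsicInterior (convex_convexHull ℝ X) ⟨0, h0⟩
  rw [intrinsicInterior_eq_image_span h0] at hy ⊢
  obtain ⟨y, hy, rfl⟩ := hy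
  have hyX : (y : E) ∈ Submodule.span ℝ X := by
    rw [← span_convexHull]
    exact y.2
  obtain ⟨t, ht, c, hc, h⟩ := exists_smul_of_mem_nnCone hX
    (mem_nnCone_of_mem_span Submodule.subset_span hN (neg_mem hyX))
  have hconv : Convex ℝ ((↑) ⁻¹' (convexHull ℝ X) : Set (Submodule.span ℝ (convexHull ℝ X))) :=
    (convex_convexHull ℝ X).linear_preimage (Submodule.span ℝ (convexHull ℝ X)).subtype
  have h1 := hconv.combo_interior_self_mem_interior hy
    (y := ⟨c, Submodule.subset_span hc⟩) hc (a := 1 / (1 + t)) (b := t / (1 + t))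
    (by positivity) (by positivity) (by field_simp)
  refine ⟨_, h1, ?_⟩
  push_cast
  rw [div_eq_inv_mul, div_eq_inv_mul, mul_smul, mul_smul, ← smul_add, ← h]
  simp

lemma zero_mem_interior_of_nnCone_eq_top [FiniteDimensional ℝ E] {X : Set E}
    (hX : X.Nonempty) (hN : ∀ y, y ∈ nnCone X) : (0 : E) ∈ interior (convexHull ℝ X) := by
  have h0 := zero_mem_intrinsicInterior_of_neg_mem_nnCone hX fun x _ => hN (-x)
  rw [intrinsicInterior_eq_image_span (intrinsicInterior_subset h0)] at h0
  have hopen : IsOpen (Submodule.span ℝ (convexHull ℝ X) : Set E) := by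
    convert isOpen_univ
    refine Set.eq_univ_of_forall fun y => ?_
    rw [span_convexHull]
    exact nnCone_subset_span X (hN y)
  exact interior_mono (image_preimage_subset _ _)
    (hopen.isOpenMap_subtype_val.image_interior_subset _ h0)

lemma mem_nnCone_of_zero_mem_interior {X : Set E}
    (h0 : (0 : E) ∈ interior (convexHull ℝ X)) (y : E) : y ∈ nnCone X := by
  have hc : Continuous fun t : ℝ => t • y := by fun_prop
  have h1 : ∀ᶠ t in nhds (0 : ℝ), t • y ∈ convexHull ℝ X := by
    refine hc.continuousAt.eventually_mem ?_
    simpa using mem_interior_iff_mem_nhds.1 h0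
  obtain ⟨ε, hε, h⟩ := Metric.eventually_nhds_iff.1 h1
  have h2 := h (y := ε / 2) (by rw [Real.dist_eq, sub_zero, abs_of_pos] <;> linarith)
  have h3 := smul_mem_nnCone (convexHull_subset_nnCone X h2) (t := (ε / 2)⁻¹) (by positivity)
  rwa [inv_smul_smul₀ (by positivity)] at h3

lemma intrinsicInterior_subset_interior_of_zero_mem {C D : Set E} (hC : Convex ℝ C) (hDC : D ⊆ C)
    (hC0 : (0 : E) ∈ interior C) (hD0 : (0 : E) ∈ D) : intrinsicInterior ℝ D ⊆ interior C := by
  intro x hx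
  obtain ⟨ε, hε, h⟩ := exists_add_smul_mem_of_mem_intrinsicInterior hD0 hx
    (Submodule.subset_span (intrinsicInterior_subset hx))
  have h1 := hC.combo_interior_self_mem_interior hC0 (hDC h) (a := ε / (1 + ε)) (b := 1 / (1 + ε))
    (by positivity) (by positivity) (by field_simp; ring)
  convert h1 using 1
  match_scalars
  field_simp

end RelInterior

section PositiveRelation

variable {E : Type*} [AddCommGroup E] [Module ℝ E]

lemma exists_pos_combination_mod_span [DecidableEq E] {U T : Finset E} {c : E → ℝ} (hc : ∀ u, 0 < c u)
    (hcU : ∑ u ∈ U, c u • u = 0) (hT : T ⊂ U) {x : E}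
    (hx : x ∈ Submodule.span ℝ (U : Set E)) :
    ∃ T' ⊆ U \ T, T ∪ T' ⊂ U ∧ ∃ μ : E → ℝ, (∀ t ∈ T', 0 < μ t) ∧
      x - ∑ t ∈ T', μ t • t ∈ Submodule.span ℝ (T : Set E) := by
  classical
  obtain ⟨a, -, rfl⟩ := Submodule.mem_span_finset.1 hx
  obtain ⟨u₀, hu₀, hmin⟩ := Finset.exists_min_image (U \ T) (fun u => a u / c u)
    (Finset.sdiff_nonempty.2 hT.2)
  set ν : E → ℝ := fun u => a u - a u₀ / c u₀ * c u with hν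
  have hν0 : ν u₀ = 0 := by
    have := (hc u₀).ne'
    simp only [hν]
    field_simp
    ring
  have hsum : ∑ u ∈ U, a u • u = ∑ u ∈ U, ν u • u := by
    simp only [hν, sub_smul, mul_smul, Finset.sum_sub_distrib]
    rw [← Finset.smul_sum, hcU, smul_zero, sub_zero]
  refine ⟨{u ∈ U \ T | ν u ≠ 0}, Finset.filter_subset _ _, ?_, ν, ?_, ?_⟩
  · refine (Finset.ssubset_iff_of_subset ?_).2 ⟨u₀, (Finset.mem_sdiff.1 hu₀).1, ?_⟩
    · exact Finset.union_subset hT.1 ((Finset.filter_subset _ _).trans Finset.sdiff_subset)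
    · simp [hν0, (Finset.mem_sdiff.1 hu₀).2]
  · intro t ht
    obtain ⟨ht, h0⟩ := Finset.mem_filter.1 ht
    refine lt_of_le_of_ne ?_ h0.symm
    have := (le_div_iff₀ (hc t)).1 (hmin t ht)
    simpa [hν] using this
  · have h1 : ∑ t ∈ U \ T with ν t ≠ 0, ν t • t = ∑ t ∈ U \ T, ν t • t := by
      refine Finset.sum_filter_of_ne fun u _ h h' => h ?_
      rw [h', zero_smul]
    rw [hsum, h1, ← Finset.sum_sdiff hT.1, add_sub_cancel_left]
    exact sum_mem fun t ht => Submodule.smul_mem _ _ (Submodule.subset_span ht)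

lemma exists_ssubset_neg_mem_nnCone [DecidableEq E] {U V : Finset E} (hUV : U ⊆ V) (hU : U.Nonempty)
    (hNU : ∀ u ∈ U, -u ∈ nnCone (U : Set E)) (hV : ∀ y, y ∈ nnCone (V : Set E)) :
    ∃ T ⊂ U, ∀ x ∈ V \ U ∪ T, -x ∈ nnCone ((V \ U ∪ T : Finset E) : Set E) := by
  obtain ⟨c, hc, hcU⟩ := exists_pos_relation hNU
  obtain ⟨a, -, ha⟩ := Submodule.mem_span_finset.1 (hV (-∑ w ∈ V \ U, w))
  have ha' : ∑ v ∈ V, (a v : ℝ) • v = -∑ w ∈ V \ U, w := ha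
  obtain ⟨T, hTU, hT, μ, hμ, h⟩ := exists_pos_combination_mod_span hc hcU
    (Finset.empty_ssubset.2 hU) (x := ∑ u ∈ U, (a u : ℝ) • u)
    (sum_mem fun u hu => Submodule.smul_mem _ _ (Submodule.subset_span hu))
  rw [Finset.empty_union] at hT
  rw [Finset.coe_empty, Submodule.span_empty, Submodule.mem_bot, sub_eq_zero] at h
  refine ⟨T, hT, neg_mem_nnCone_of_pos_relation
    (w := fun x => if x ∈ U then μ x else 1 + a x) ?_ subset_rfl ?_⟩
  · intro x hx
    rcases Finset.mem_union.1 hx with hx | hx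
    · rw [if_neg (Finset.mem_sdiff.1 hx).2]
      positivity
    · rw [if_pos (hT.1 hx)]
      exact hμ x hx
  · have hd : Disjoint (V \ U) T := Finset.disjoint_of_subset_right hT.1 Finset.sdiff_disjoint
    have h1 : ∑ x ∈ V \ U, (if x ∈ U then μ x else 1 + (a x : ℝ)) • x =
        ∑ x ∈ V \ U, x + ∑ x ∈ V \ U, (a x : ℝ) • x := by
      rw [← Finset.sum_add_distrib]
      refine Finset.sum_congr rfl fun x hx => ?_
      rw [if_neg (Finset.mem_sdiff.1 hx).2, add_smul, one_smul]
    have h2 : ∑ x ∈ T, (if x ∈ U then μ x else 1 + (a x : ℝ)) • x = ∑ x ∈ T, μ x • x :=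
      Finset.sum_congr rfl fun x hx => by rw [if_pos (hT.1 hx)]
    rw [Finset.sum_union hd, h1, h2, ← h, add_assoc, Finset.sum_sdiff hUV, ha', add_neg_cancel,
      neg_zero]
    exact zero_mem _

lemma exists_ssubset_neg_mem_nnCone_inf_le [DecidableEq E] {U V : Finset E} (hUV : U ⊆ V) (hU : U.Nonempty)
    (hNU : ∀ u ∈ U, -u ∈ nnCone (U : Set E)) (hV : ∀ y, y ∈ nnCone (V : Set E)) :
    ∃ T ⊂ U, (∀ x ∈ V \ U ∪ T, -x ∈ nnCone ((V \ U ∪ T : Finset E) : Set E)) ∧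
      Submodule.span ℝ ((V \ U ∪ T : Finset E) : Set E) ⊓ Submodule.span ℝ (U : Set E) ≤
        Submodule.span ℝ (T : Set E) := by
  classical
  obtain ⟨T₀, hT₀, hN₀⟩ := exists_ssubset_neg_mem_nnCone hUV hU hNU hV
  obtain ⟨T, hT, hmax⟩ := Finset.exists_max_image
    {T ∈ U.ssubsets | ∀ x ∈ V \ U ∪ T, -x ∈ nnCone ((V \ U ∪ T : Finset E) : Set E)} Finset.card
    ⟨T₀, Finset.mem_filter.2 ⟨Finset.mem_ssubsets.2 hT₀, hN₀⟩⟩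
  obtain ⟨hTU, hN⟩ := Finset.mem_filter.1 hT
  rw [Finset.mem_ssubsets] at hTU
  refine ⟨T, hTU, hN, ?_⟩
  rintro x ⟨hxW, hxU⟩
  obtain ⟨c, hc, hcU⟩ := exists_pos_relation hNU
  obtain ⟨T', hT', hTT', μ, hμ, h⟩ := exists_pos_combination_mod_span hc hcU hTU hxU
  have hsub : V \ U ∪ T ⊆ V \ U ∪ (T ∪ T') := by grind
  have hle : nnCone ((V \ U ∪ T : Finset E) : Set E) ≤
      nnCone ((V \ U ∪ (T ∪ T') : Finset E) : Set E) :=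
    Submodule.span_mono (Finset.coe_subset.2 hsub)
  have h1 : -(∑ t ∈ T', μ t • t) ∈ Submodule.span ℝ ((V \ U ∪ T : Finset E) : Set E) := by
    have h2 : -(∑ t ∈ T', μ t • t) = (x - ∑ t ∈ T', μ t • t) - x := by abel
    rw [h2]
    refine sub_mem (Submodule.span_mono ?_ h) hxW
    exact Finset.coe_subset.2 Finset.subset_union_right
  have h3 := hle (mem_nnCone_of_mem_span Submodule.subset_span hN h1)
  have h4 := neg_mem_nnCone_of_pos_relation hμ
    (Finset.coe_subset.2 (by grind : T' ⊆ V \ U ∪ (T ∪ T'))) h3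
  have h5 := hmax (T ∪ T') (Finset.mem_filter.2 ⟨Finset.mem_ssubsets.2 hTT', fun y hy => by
    rcases Finset.mem_union.1 hy with hy' | hy'
    · exact hle (hN y (Finset.mem_union_left _ hy'))
    · rcases Finset.mem_union.1 hy' with hy' | hy'
      · exact hle (hN y (Finset.mem_union_right _ hy'))
      · exact h4 y hy'⟩)
  have h6 : T' = ∅ := by
    have h7 := Finset.eq_of_subset_of_card_le (Finset.subset_union_left (s₂ := T')) h5
    refine Finset.eq_empty_of_forall_notMem fun t ht => (Finset.mem_sdiff.1 (hT' ht)).2 ?_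
    rw [h7]
    exact Finset.mem_union_right _ ht
  simpa [h6] using h

lemma span_erase_eq_of_neg_mem_nnCone [DecidableEq E] {U : Finset E} (hNU : ∀ u ∈ U, -u ∈ nnCone (U : Set E))
    {u : E} (hu : u ∈ U) :
    Submodule.span ℝ ((U.erase u : Finset E) : Set E) = Submodule.span ℝ (U : Set E) := by
  obtain ⟨c, hc, hcU⟩ := exists_pos_relation hNU
  refine le_antisymm (Submodule.span_mono (Finset.coe_subset.2 (Finset.erase_subset u U))) ?_
  refine Submodule.span_le.2 fun x hx => ?_
  by_cases h : x = u
  · subst h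
    rw [← Finset.add_sum_erase U _ hu, add_eq_zero_iff_eq_neg] at hcU
    have h1 : x = (c x)⁻¹ • -(∑ y ∈ U.erase x, c y • y) := by
      rw [← hcU, inv_smul_smul₀ (hc x).ne']
    have h2 : (c x)⁻¹ • -(∑ y ∈ U.erase x, c y • y) ∈
        Submodule.span ℝ ((U.erase x : Finset E) : Set E) :=
      Submodule.smul_mem _ _ (neg_mem (sum_mem fun y hy =>
        Submodule.smul_mem _ _ (Submodule.subset_span hy)))
    rwa [← h1] at h2
  · exact Submodule.subset_span (Finset.mem_coe.2 (Finset.mem_erase.2 ⟨h, hx⟩))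

lemma finrank_span_lt_card_of_neg_mem_nnCone {U : Finset E} (hU : U.Nonempty)
    (hNU : ∀ u ∈ U, -u ∈ nnCone (U : Set E)) :
    Module.finrank ℝ (Submodule.span ℝ (U : Set E)) < U.card := by
  classical
  obtain ⟨u, hu⟩ := hU
  rw [← span_erase_eq_of_neg_mem_nnCone hNU hu]
  exact (finrank_span_finset_le_card _).trans_lt (Finset.card_erase_lt_of_mem hu)

lemma finrank_span_eq_card_of_ssubset {U T : Finset E} (hT : T ⊂ U)
    (hNU : ∀ u ∈ U, -u ∈ nnCone (U : Set E))
    (hcard : U.card = Module.finrank ℝ (Submodule.span ℝ (U : Set E)) + 1) :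
    Module.finrank ℝ (Submodule.span ℝ (T : Set E)) = T.card := by
  classical
  obtain ⟨u, hu, huT⟩ := Finset.exists_of_ssubset hT
  have h1 : LinearIndepOn ℝ id ((U.erase u : Finset E) : Set E) := by
    change LinearIndependent ℝ (Subtype.val : {x // x ∈ U.erase u} → E)
    rw [linearIndependent_iff_card_eq_finrank_span]
    have h2 : Set.range (Subtype.val : {x // x ∈ U.erase u} → E) =
        ((U.erase u : Finset E) : Set E) := Subtype.range_coe
    rw [h2, Set.finrank, span_erase_eq_of_neg_mem_nnCone hNU hu, Fintype.card_coe,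
      Finset.card_erase_of_mem hu, hcard, Nat.add_sub_cancel]
  have h3 : LinearIndepOn ℝ id (T : Set E) :=
    h1.mono
      (Finset.coe_subset.2 (Finset.subset_erase.2 ⟨hT.1, huT⟩))
  exact finrank_span_finset_eq_card h3

end PositiveRelation

section LatticePolytope

variable {d : ℕ} {P : Set (Fin d → ℝ)}

lemma Bornology.IsBounded.finite_isLatticePt (hP : Bornology.IsBounded P) :
    {x ∈ P | IsLatticePt x}.Finite := by
  obtain ⟨R, hR⟩ := hP.exists_norm_le
  have hfin : {x : Fin d → ℝ | ∀ i, x i ∈ (fun z : ℤ => (z : ℝ)) '' Icc (-⌈R⌉) ⌈R⌉}.Finite :=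
    Set.Finite.pi' fun _ => (Set.finite_Icc _ _).image _
  refine hfin.subset ?_
  rintro x ⟨hx, hl⟩ i
  obtain ⟨z, hz⟩ := hl i
  have h1 : |x i| ≤ ⌈R⌉ := (norm_le_pi_norm x i).trans ((hR x hx).trans (Int.le_ceil R))
  rw [hz, ← Int.cast_abs, Int.cast_le, abs_le] at h1
  exact ⟨z, h1, hz.symm⟩

lemma IsLatticePolytope.isCompact (hP : IsLatticePolytope P) : IsCompact P := by
  obtain ⟨V, -, rfl⟩ := hP
  exact V.finite_toSet.isCompact_convexHull ℝ

lemma IsLatticePolytope.exists_extremePoints (hP : IsLatticePolytope P) :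
    ∃ V : Finset (Fin d → ℝ), (V : Set (Fin d → ℝ)) = extremePoints ℝ P ∧
      (∀ v ∈ V, IsLatticePt v) ∧ P = convexHull ℝ (V : Set (Fin d → ℝ)) := by
  have hcomp := hP.isCompact
  obtain ⟨V, hV, rfl⟩ := hP
  have hsub : extremePoints ℝ (convexHull ℝ (V : Set (Fin d → ℝ))) ⊆ V :=
    extremePoints_convexHull_subset
  have hfin := V.finite_toSet.subset hsub
  refine ⟨hfin.toFinset, hfin.coe_toFinset, fun v hv => hV v (hsub (hfin.mem_toFinset.1 hv)), ?_⟩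
  rw [hfin.coe_toFinset]
  have h := closure_convexHull_extremePoints hcomp (convex_convexHull ℝ (V : Set (Fin d → ℝ)))
  rwa [(hfin.isClosed_convexHull ℝ).closure_eq, eq_comm] at h

lemma IsMinimalCanonicalFano.not_forall_mem_nnCone (hP : IsMinimalCanonicalFano P) (hd : d ≠ 0)
    {v : Fin d → ℝ} (hv : v ∈ extremePoints ℝ P) {X : Set (Fin d → ℝ)}
    (hX : X ⊆ {x ∈ P | IsLatticePt x} \ {v}) : ¬ ∀ y, y ∈ nnCone X := by
  intro h
  have hne : X.Nonempty := by
    by_contra hne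
    rw [not_nonempty_iff_eq_empty] at hne
    have h1 := h fun _ => 1
    rw [hne, nnCone, Submodule.span_empty, Submodule.mem_bot] at h1
    exact one_ne_zero (congrFun h1 ⟨0, Nat.pos_of_ne_zero hd⟩)
  have hconv : Convex ℝ P := by
    obtain ⟨V, -, rfl⟩ := hP.1.1
    exact convex_convexHull ℝ _
  have hfin := hP.1.1.isCompact.isBounded.finite_isLatticePt.subset
    (sdiff_subset : {x ∈ P | IsLatticePt x} \ {v} ⊆ _)
  refine hP.2 v hv ⟨⟨hfin.toFinset, fun x hx => (hfin.mem_toFinset.1 hx).1.2, ?_⟩, ?_⟩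
  · rw [hfin.coe_toFinset]
  · refine Subset.antisymm ?_ ?_
    · rw [← hP.1.2]
      rintro x ⟨hx, hl⟩
      exact ⟨interior_mono (convexHull_min (fun y hy => hy.1.1) hconv) hx, hl⟩
    · rintro _ rfl
      refine ⟨interior_mono (convexHull_mono hX) (zero_mem_interior_of_nnCone_eq_top hne h), ?_⟩
      exact fun _ => ⟨0, by simp⟩

lemma IsMinimalCanonicalFano.convexHull_of_neg_mem_nnCone (hP : IsMinimalCanonicalFano P)
    (hd : d ≠ 0) {X : Finset (Fin d → ℝ)} (hXP : (X : Set (Fin d → ℝ)) ⊆ extremePoints ℝ P)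
    (hX : X.Nonempty) (hN : ∀ x ∈ X, -x ∈ nnCone (X : Set (Fin d → ℝ))) :
    IsMinimalCanonicalFanoOfDim (Module.finrank ℝ (Submodule.span ℝ (X : Set (Fin d → ℝ))))
      (convexHull ℝ (X : Set (Fin d → ℝ))) := by
  obtain ⟨V, hVP, hVl, hPV⟩ := hP.1.1.exists_extremePoints
  have hXV : X ⊆ V := by rwa [← Finset.coe_subset, hVP]
  have h0P : (0 : Fin d → ℝ) ∈ interior P := by
    have : (0 : Fin d → ℝ) ∈ {x ∈ interior P | IsLatticePt x} := hP.1.2 ▸ rfl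
    exact this.1
  have hconv : Convex ℝ P := hPV ▸ convex_convexHull ℝ _
  have hsub : convexHull ℝ (X : Set (Fin d → ℝ)) ⊆ P :=
    convexHull_min (hXP.trans extremePoints_subset) hconv
  have h0 := zero_mem_intrinsicInterior_of_neg_mem_nnCone (Finset.coe_nonempty.2 hX) hN
  have h0' := intrinsicInterior_subset h0
  refine ⟨⟨⟨X, fun x hx => hVl x (hXV hx), rfl⟩, ?_, ?_⟩, ?_⟩
  · rw [vectorSpan_eq_span_of_zero_mem h0', span_convexHull]
  · refine Subset.antisymm ?_ ?_
    · rw [← hP.1.2]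
      rintro x ⟨hx, hl⟩
      exact ⟨intrinsicInterior_subset_interior_of_zero_mem hconv hsub h0P h0' hx, hl⟩
    · rintro _ rfl
      exact ⟨h0, fun _ => ⟨0, by simp⟩⟩
  · rintro v hv ⟨-, hdim, hint⟩
    have hvX : v ∈ X := extremePoints_convexHull_subset hv
    set B : Set (Fin d → ℝ) :=
      {x ∈ convexHull ℝ (X : Set (Fin d → ℝ)) | IsLatticePt x} \ {v} with hB
    have hB0 : (0 : Fin d → ℝ) ∈ intrinsicInterior ℝ (convexHull ℝ B) := by
      have : (0 : Fin d → ℝ) ∈ {x ∈ intrinsicInterior ℝ (convexHull ℝ B) | IsLatticePt x} :=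
        hint ▸ rfl
      exact this.1
    rw [vectorSpan_eq_span_of_zero_mem (intrinsicInterior_subset hB0), span_convexHull] at hdim
    have hspan : Submodule.span ℝ B = Submodule.span ℝ (X : Set (Fin d → ℝ)) := by
      refine Submodule.eq_of_le_of_finrank_eq ?_ hdim
      rw [← span_convexHull (X : Set (Fin d → ℝ))]
      exact Submodule.span_mono fun x hx => hx.1.1
    have hvB : v ∈ nnCone B := by
      refine mem_nnCone_of_mem_span Submodule.subset_span
        (neg_mem_nnCone_of_zero_mem_intrinsicInterior hB0) ?_
      rw [hspan]
      exact Submodule.subset_span hvX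
    refine hP.not_forall_mem_nnCone hd (hXP hvX) subset_rfl fun y => ?_
    have hBA : B ⊆ {x ∈ P | IsLatticePt x} \ {v} := fun x hx => ⟨⟨hsub hx.1.1, hx.1.2⟩, hx.2⟩
    have hy : y ∈ nnCone (V : Set (Fin d → ℝ)) := mem_nnCone_of_zero_mem_interior (hPV ▸ h0P) y
    refine (Submodule.span_le.2 fun w hw => ?_ : nnCone (V : Set (Fin d → ℝ)) ≤ _) hy
    by_cases hwv : w = v
    · exact hwv ▸ Submodule.span_mono hBA hvB
    · exact Submodule.subset_span
        ⟨⟨extremePoints_subset (hVP ▸ hw : w ∈ extremePoints ℝ P), hVl w hw⟩, hwv⟩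

end LatticePolytope

/-- A minimal canonical Fano `d`-polytope `P` that is not a simplex
contains a minimal canonical Fano `k`-simplex `S` (for some `1 ≤ k < d`) with
`vert(S) ⊆ vert(P)`; and for any such `S` there are `0 ≤ s < k` and a minimal canonical
Fano `(d - k + s)`-polytope `P'` with `vert(P') ⊆ vert(P)` such that
`P = conv(S ∪ P')` and `s = |vert(S) ∩ vert(P')|`. -/
theorem minimal_decomposition_step (d : ℕ) (P : Set (Fin d → ℝ))
    (hP : IsMinimalCanonicalFano P) (hns : ¬ ∃ k, IsSimplexOfDim k P) :
    (∃ k, 1 ≤ k ∧ k < d ∧ ∃ S : Set (Fin d → ℝ), IsSimplexOfDim k S ∧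
      IsMinimalCanonicalFanoOfDim k S ∧ S ⊆ P ∧
      Set.extremePoints ℝ S ⊆ Set.extremePoints ℝ P) ∧
    (∀ k, 1 ≤ k → k < d → ∀ S : Set (Fin d → ℝ), IsSimplexOfDim k S →
      IsMinimalCanonicalFanoOfDim k S → S ⊆ P →
      Set.extremePoints ℝ S ⊆ Set.extremePoints ℝ P →
      ∃ s, s < k ∧ ∃ P' : Set (Fin d → ℝ), IsMinimalCanonicalFanoOfDim (d - k + s) P' ∧
        Set.extremePoints ℝ P' ⊆ Set.extremePoints ℝ P ∧
        P = convexHull ℝ (S ∪ P') ∧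
        s = (Set.extremePoints ℝ S ∩ Set.extremePoints ℝ P').ncard) := by
  classical
  have hd : d ≠ 0 := by
    rintro rfl
    have h0 : (0 : Fin 0 → ℝ) ∈ P := by
      have : (0 : Fin 0 → ℝ) ∈ {x ∈ interior P | IsLatticePt x} := hP.1.2 ▸ rfl
      exact interior_subset this.1
    have : Subsingleton (Fin (0 + 1)) := inferInstanceAs (Subsingleton (Fin 1))
    refine hns ⟨0, fun _ => 0, affineIndependent_of_subsingleton ℝ _, ?_⟩
    rw [Set.range_const, convexHull_singleton]
    exact Subset.antisymm (fun x _ => Subsingleton.elim _ _) (singleton_subset_iff.2 h0)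
  obtain ⟨V, hVP, hVl, hPV⟩ := hP.1.1.exists_extremePoints
  have hconv : Convex ℝ P := hPV ▸ convex_convexHull ℝ _
  have h0P : (0 : Fin d → ℝ) ∈ interior P := by
    have : (0 : Fin d → ℝ) ∈ {x ∈ interior P | IsLatticePt x} := hP.1.2 ▸ rfl
    exact this.1
  have hVtop : ∀ y, y ∈ nnCone (V : Set (Fin d → ℝ)) := mem_nnCone_of_zero_mem_interior (hPV ▸ h0P)
  have hmin : ∀ v ∈ V, ∀ X : Finset (Fin d → ℝ), X ⊆ V → v ∉ X →
      ¬ ∀ y, y ∈ nnCone (X : Set (Fin d → ℝ)) := by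
    intro v hv X hX hvX
    refine hP.not_forall_mem_nnCone hd (hVP ▸ hv : v ∈ extremePoints ℝ P) fun x hx => ?_
    exact ⟨⟨extremePoints_subset (hVP ▸ hX hx : x ∈ extremePoints ℝ P), hVl x (hX hx)⟩,
      fun h => hvX (h ▸ hx)⟩
  constructor
  · have h0V : (0 : Fin d → ℝ) ∉ V := by
      intro h0
      refine hmin 0 h0 (V.erase 0) (Finset.erase_subset _ _) (Finset.notMem_erase _ _) fun y => ?_
      refine (Submodule.span_le.2 fun v hv => ?_ : nnCone (V : Set (Fin d → ℝ)) ≤ _) (hVtop y)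
      by_cases hv0 : v = 0
      · rw [hv0]
        exact zero_mem _
      · exact Submodule.subset_span (Finset.mem_coe.2 (Finset.mem_erase.2 ⟨hv0, hv⟩))
    have h0 : (0 : Fin d → ℝ) ∈ convexHull ℝ (V : Set (Fin d → ℝ)) := hPV ▸ interior_subset h0P
    obtain ⟨ι, _, z, w, hzV, hz, hw, hw1, hwz⟩ := eq_pos_convex_span_of_mem_convexHull h0
    have hne : Nonempty ι := by
      by_contra h
      rw [not_nonempty_iff] at h
      simp at hw1
    obtain ⟨k, hk⟩ := Nat.exists_eq_succ_of_ne_zero (Fintype.card_ne_zero (α := ι))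
    set U : Finset (Fin d → ℝ) := Finset.univ.image z with hU
    have hUz : (U : Set (Fin d → ℝ)) = Set.range z := by simp [hU]
    have hUV : U ⊆ V := by rwa [← Finset.coe_subset, hUz]
    have hUne : U.Nonempty := Finset.univ_nonempty.image z
    have hNU : ∀ u ∈ U, -u ∈ nnCone (U : Set (Fin d → ℝ)) := by
      have h1 : ∀ u ∈ U, 0 < Function.extend z w 0 u := by
        intro u hu
        obtain ⟨i, -, rfl⟩ := Finset.mem_image.1 hu
        rw [hz.injective.extend_apply]
        exact hw i
      refine neg_mem_nnCone_of_pos_relation h1 subset_rfl ?_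
      rw [hU, Finset.sum_image hz.injective.injOn]
      simp only [hz.injective.extend_apply, hwz, neg_zero, zero_mem]
    have hmc := hP.convexHull_of_neg_mem_nnCone hd
      (by rw [← hVP]; exact Finset.coe_subset.2 hUV) hUne hNU
    have hdim : Module.finrank ℝ (Submodule.span ℝ (U : Set (Fin d → ℝ))) = k := by
      rw [← hmc.1.2.1, ← direction_affineSpan, affineSpan_convexHull, direction_affineSpan, hUz]
      exact hz.finrank_vectorSpan hk
    have hsimplex : IsSimplexOfDim k (convexHull ℝ (U : Set (Fin d → ℝ))) := by
      let e := (Fintype.equivFinOfCardEq hk).symm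
      refine ⟨z ∘ e, hz.comp_embedding e.toEmbedding, ?_⟩
      rw [e.surjective.range_comp, hUz]
    have hUsub : convexHull ℝ (U : Set (Fin d → ℝ)) ⊆ P := by
      rw [hPV]
      exact convexHull_mono (Finset.coe_subset.2 hUV)
    refine ⟨k, ?_, ?_, _, hsimplex, hdim ▸ hmc, hUsub, ?_⟩
    · rw [Nat.one_le_iff_ne_zero]
      rintro rfl
      obtain ⟨u, hu⟩ := hUne
      rw [Submodule.finrank_eq_zero] at hdim
      have hu0 := Submodule.subset_span (R := ℝ) (Finset.mem_coe.2 hu)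
      rw [hdim] at hu0
      exact h0V ((Submodule.mem_bot ℝ).1 hu0 ▸ hUV hu)
    · have hle : k ≤ d := by
        have h1 := Submodule.finrank_le (Submodule.span ℝ (U : Set (Fin d → ℝ)))
        rwa [hdim, Module.finrank_fin_fun] at h1
      refine lt_of_le_of_ne hle fun hkd => ?_
      have htop : Submodule.span ℝ (U : Set (Fin d → ℝ)) = ⊤ :=
        Submodule.eq_top_of_finrank_eq (by rw [hdim, hkd, Module.finrank_fin_fun])
      have hVU : V ⊆ U := by
        intro v hv
        by_contra hvU
        refine hmin v hv U hUV hvU fun y => ?_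
        refine mem_nnCone_of_mem_span Submodule.subset_span hNU ?_
        rw [htop]
        trivial
      refine hns ⟨k, ?_⟩
      rwa [hPV, hVU.antisymm hUV]
    · rw [← hVP]
      exact extremePoints_convexHull_subset.trans (Finset.coe_subset.2 hUV)
  · intro k hk hkd S hSk hSm hSP hSV
    obtain ⟨U, hUS, -, hSU⟩ := hSm.1.1.exists_extremePoints
    have hUV : U ⊆ V := by
      rw [← Finset.coe_subset, hUS, hVP]
      exact hSV
    have h0S : (0 : Fin d → ℝ) ∈ intrinsicInterior ℝ (convexHull ℝ (U : Set (Fin d → ℝ))) := by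
      have : (0 : Fin d → ℝ) ∈ {x ∈ intrinsicInterior ℝ S | IsLatticePt x} := hSm.1.2.2 ▸ rfl
      exact hSU ▸ this.1
    have hNU := neg_mem_nnCone_of_zero_mem_intrinsicInterior h0S
    have hUne : U.Nonempty := by
      rw [← Finset.coe_nonempty, ← convexHull_nonempty_iff (𝕜 := ℝ)]
      exact ⟨0, intrinsicInterior_subset h0S⟩
    have hdim : Module.finrank ℝ (Submodule.span ℝ (U : Set (Fin d → ℝ))) = k := by
      rw [← span_convexHull, ← vectorSpan_eq_span_of_zero_mem (intrinsicInterior_subset h0S), ← hSU]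
      exact hSm.1.2.1
    have hcard : U.card = k + 1 := by
      refine le_antisymm ?_ (hdim ▸ finrank_span_lt_card_of_neg_mem_nnCone hUne hNU)
      obtain ⟨f, -, hf⟩ := hSk
      have h1 : U ⊆ Finset.univ.image f := by
        rw [← Finset.coe_subset, hUS, hf, Finset.coe_image, Finset.coe_univ, image_univ]
        exact extremePoints_convexHull_subset
      simpa using (Finset.card_le_card h1).trans Finset.card_image_le
    obtain ⟨T, hTU, hN, hinf⟩ := exists_ssubset_neg_mem_nnCone_inf_le hUV hUne hNU hVtop
    have hTcard := finrank_span_eq_card_of_ssubset hTU hNU (by rw [hdim, hcard])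
    set X := V \ U ∪ T with hX
    have hXV : X ⊆ V := Finset.union_subset Finset.sdiff_subset (hTU.1.trans hUV)
    have hTX : Submodule.span ℝ (T : Set (Fin d → ℝ)) ≤ Submodule.span ℝ (X : Set (Fin d → ℝ)) :=
      Submodule.span_mono (Finset.coe_subset.2 Finset.subset_union_right)
    have hXU : X ∪ U = V := by
      rw [hX, Finset.union_assoc, Finset.union_eq_right.2 hTU.1, Finset.sdiff_union_of_subset hUV]
    have hVspan : Submodule.span ℝ (V : Set (Fin d → ℝ)) = ⊤ :=
      eq_top_iff.2 fun y _ => nnCone_subset_span _ (hVtop y)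
    have hsup : Submodule.span ℝ (X : Set (Fin d → ℝ)) ⊔ Submodule.span ℝ (U : Set (Fin d → ℝ)) =
        ⊤ := by
      rw [← Submodule.span_union, ← Finset.coe_union, hXU, hVspan]
    have hinf' : Submodule.span ℝ (X : Set (Fin d → ℝ)) ⊓ Submodule.span ℝ (U : Set (Fin d → ℝ)) =
        Submodule.span ℝ (T : Set (Fin d → ℝ)) :=
      le_antisymm hinf (le_inf hTX (Submodule.span_mono (Finset.coe_subset.2 hTU.1)))
    have hfr := Submodule.finrank_sup_add_finrank_inf_eq (Submodule.span ℝ (X : Set (Fin d → ℝ)))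
      (Submodule.span ℝ (U : Set (Fin d → ℝ)))
    rw [hsup, hinf', finrank_top, Module.finrank_fin_fun, hTcard, hdim] at hfr
    have hTlt : T.card < U.card := Finset.card_lt_card hTU
    have hTk : T.card < k := by
      refine lt_of_le_of_ne (by omega) fun hTk => ?_
      have hXtop : Submodule.span ℝ (X : Set (Fin d → ℝ)) = ⊤ :=
        Submodule.eq_top_of_finrank_eq (by rw [Module.finrank_fin_fun]; omega)
      obtain ⟨u, hu, huT⟩ := Finset.exists_of_ssubset hTU
      refine hmin u (hUV hu) X hXV (by grind) fun y => ?_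
      refine mem_nnCone_of_mem_span Submodule.subset_span hN ?_
      rw [hXtop]
      trivial
    have hXP : (X : Set (Fin d → ℝ)) ⊆ extremePoints ℝ P := by
      rw [← hVP]
      exact Finset.coe_subset.2 hXV
    have hXne : X.Nonempty := by
      rw [Finset.nonempty_iff_ne_empty]
      intro h
      rw [h, Finset.coe_empty, Submodule.span_empty, finrank_bot] at hfr
      omega
    have hXext : extremePoints ℝ (convexHull ℝ (X : Set (Fin d → ℝ))) = X := by
      refine Subset.antisymm extremePoints_convexHull_subset fun x hx => ?_
      refine inter_extremePoints_subset_extremePoints_of_subset ?_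
        ⟨subset_convexHull ℝ _ hx, hXP hx⟩
      exact convexHull_min (hXP.trans extremePoints_subset) hconv
    refine ⟨T.card, hTk, convexHull ℝ (X : Set (Fin d → ℝ)), ?_, ?_, ?_, ?_⟩
    · have h1 : d - k + T.card =
          Module.finrank ℝ (Submodule.span ℝ (X : Set (Fin d → ℝ))) := by omega
      rw [h1]
      exact hP.convexHull_of_neg_mem_nnCone hd hXP hXne hN
    · rwa [hXext]
    · rw [hSU, convexHull_convexHull_union_left, convexHull_convexHull_union_right,
        ← Finset.coe_union, Finset.union_comm, hXU]
      exact hPV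
    · rw [hXext, ← hUS, ← Finset.coe_inter, ncard_coe_finset]
      congr 1
      grind
end

section
/- Let P ⊂ ℝ^d be a minimal canonical Fano polytope of dimension d that is not a simplex. Then there exist an integer t with 2 ≤ t ≤ d and minimal canonical Fano simplices S_1, …, S_t (each S_i of dimension d_i ≥ 1, a minimal canonical Fano simplex with respect to lin(S_i) ∩ ℤ^d, with vert(S_i) ⊆ vert(P)) such that P = conv(S_1 ∪ ⋯ ∪ S_t) and, setting r_1 = 0 and r_i = |vert(S_i) ∩ vert(P^{(i−1)})| where P^{(i−1)} = conv(S_1 ∪ ⋯ ∪ S_{i−1}) for 2 ≤ i ≤ t, the following hold: (1) d_1 + ⋯ + d_t = d + r where r = r_1 + ⋯ + r_t; (2) r_i < d_i ≤ d − t + 1 for each 1 ≤ i ≤ t; (3) |vert(P)| = d + t. -/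
open MeasureTheory Set
open scoped ENNReal

open Classical in
theorem sum_dite_smul {ι M : Type*} [AddCommGroup M] [Module ℝ M] {C : Finset ι} {s : Finset C}
    {w : C → ℝ} (g : ι → M) :
    ∑ x ∈ C, (if h : x ∈ C then (if (⟨x, h⟩ : C) ∈ s then w ⟨x, h⟩ else 0) else 0) • g x =
      ∑ e ∈ s, w e • g e := by
  rw [← Finset.sum_coe_sort C, ← Finset.sum_subset (Finset.subset_univ s)]
  · exact Finset.sum_congr rfl fun e he => by simp [he]
  · intro e _ he
    simp [he]

theorem sum_card_eq_card_biUnion_add {ι : Type*} [DecidableEq ι] (C : ℕ → Finset ι) (t : ℕ) :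
    ∑ i ∈ Finset.range t, (C i).card = ((Finset.range t).biUnion C).card +
      ∑ i ∈ Finset.range t, (C i ∩ (Finset.range i).biUnion C).card := by
  induction t with
  | zero => simp
  | succ t ih =>
    rw [Finset.sum_range_succ, Finset.sum_range_succ, ih, Finset.range_add_one,
      Finset.biUnion_insert]
    have := Finset.card_union_add_card_inter (C t) ((Finset.range t).biUnion C)
    omega

section PositiveRelations

variable {E : Type*} [AddCommGroup E] [Module ℝ E]

/-- `D` is nonempty and carries a linear relation modulo `L` with positive coefficients. -/
def PosRel (L : Submodule ℝ E) (D : Finset E) : Prop :=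
  D.Nonempty ∧ ∃ c : E → ℝ, (∀ v ∈ D, 0 < c v) ∧ ∑ v ∈ D, c v • v ∈ L

theorem mem_nnspan_finset {A : Finset E} {x : E} :
    x ∈ Submodule.span NNReal (A : Set E) ↔
      ∃ b : E → ℝ, (∀ v, 0 ≤ b v) ∧ ∑ v ∈ A, b v • v = x := by
  constructor
  · intro hx
    obtain ⟨f, -, hf⟩ := Submodule.mem_span_finset.1 hx
    exact ⟨fun v => f v, fun v => (f v).2, hf⟩
  · rintro ⟨b, hb, rfl⟩
    refine Submodule.sum_mem _ fun v hv => ?_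
    exact Submodule.smul_mem _ (⟨b v, hb v⟩ : NNReal) (Submodule.subset_span hv)

theorem smul_mem_nnspan {s : Set E} {x : E} {r : ℝ} (hr : 0 ≤ r)
    (hx : x ∈ Submodule.span NNReal s) : r • x ∈ Submodule.span NNReal s :=
  Submodule.smul_mem _ (⟨r, hr⟩ : NNReal) hx

theorem mem_nnspan_of_mem_span {s : Set E} (hs : ∀ v ∈ s, -v ∈ Submodule.span NNReal s)
    {x : E} (hx : x ∈ Submodule.span ℝ s) : x ∈ Submodule.span NNReal s := by
  suffices h : x ∈ Submodule.span NNReal s ∧ -x ∈ Submodule.span NNReal s from h.1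
  induction hx using Submodule.span_induction with
  | mem v hv => exact ⟨Submodule.subset_span hv, hs v hv⟩
  | zero => simp
  | add y z _ _ hy hz =>
    refine ⟨add_mem hy.1 hz.1, ?_⟩
    rw [neg_add]
    exact add_mem hy.2 hz.2
  | smul r y _ hy =>
    rcases le_total 0 r with hr | hr
    · refine ⟨smul_mem_nnspan hr hy.1, ?_⟩
      rw [← smul_neg]
      exact smul_mem_nnspan hr hy.2
    · have hr' : 0 ≤ -r := by linarith
      refine ⟨?_, ?_⟩
      · rw [← neg_smul_neg]
        exact smul_mem_nnspan hr' hy.2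
      · rw [← neg_smul]
        exact smul_mem_nnspan hr' hy.1

theorem PosRel.neg_mem_nnspan {A : Finset E} (hA : PosRel ⊥ A) {v : E} (hv : v ∈ A) :
    -v ∈ Submodule.span NNReal (A : Set E) := by
  classical
  obtain ⟨-, c, hc, h⟩ := hA
  rw [Submodule.mem_bot, ← Finset.add_sum_erase _ _ hv] at h
  have h1 : ∑ u ∈ A.erase v, c u • u ∈ Submodule.span NNReal (A : Set E) :=
    Submodule.sum_mem _ fun u hu => smul_mem_nnspan (hc u (Finset.mem_of_mem_erase hu)).le
      (Submodule.subset_span (Finset.mem_of_mem_erase hu))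
  have h2 : -v = (c v)⁻¹ • ∑ u ∈ A.erase v, c u • u := by
    rw [eq_neg_of_add_eq_zero_right h, smul_neg, smul_smul, inv_mul_cancel₀ (hc v hv).ne', one_smul]
  rw [h2]
  exact smul_mem_nnspan (inv_nonneg.2 (hc v hv).le) h1

/-- The relations on a minimal positively dependent set form a line. -/
theorem eq_mul_of_minimal_posRel {L : Submodule ℝ E} {D : Finset E}
    (hD : Minimal (PosRel L) D) {c : E → ℝ} (hc : ∀ v ∈ D, 0 < c v)
    (hcL : ∑ v ∈ D, c v • v ∈ L) {a : E → ℝ} (ha : ∑ v ∈ D, a v • v ∈ L) :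
    ∃ r : ℝ, ∀ v ∈ D, a v = r * c v := by
  classical
  obtain ⟨w, hw, hmin⟩ := D.exists_min_image (fun v => a v / c v) hD.prop.1
  refine ⟨a w / c w, ?_⟩
  have hb : ∀ v ∈ D, 0 ≤ a v - a w / c w * c v := fun v hv => by
    have := (le_div_iff₀ (hc v hv)).1 (hmin v hv)
    linarith
  by_contra! hne
  obtain ⟨u, hu, hne⟩ := hne
  have hsub : D.filter (fun v => 0 < a v - a w / c w * c v) ⊆ D := Finset.filter_subset _ _
  have hrel : PosRel L (D.filter fun v => 0 < a v - a w / c w * c v) := by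
    refine ⟨⟨u, ?_⟩, fun v => a v - a w / c w * c v, fun v hv => (Finset.mem_filter.1 hv).2, ?_⟩
    · exact Finset.mem_filter.2 ⟨hu, lt_of_le_of_ne (hb u hu) (sub_ne_zero.2 hne).symm⟩
    · rw [Finset.sum_subset hsub]
      · simp only [sub_smul, mul_smul, Finset.sum_sub_distrib, ← Finset.smul_sum]
        exact L.sub_mem ha (L.smul_mem _ hcL)
      · intro v hv hv'
        have h0 : a v - a w / c w * c v = 0 :=
          le_antisymm (not_lt.1 fun h => hv' (Finset.mem_filter.2 ⟨hv, h⟩)) (hb v hv)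
        simp only [h0, zero_smul]
  have := (Finset.mem_filter.1 (hD.2 hrel hsub hw)).2
  rw [div_mul_cancel₀ _ (hc w hw).ne', sub_self] at this
  exact this.false

theorem finrank_sup_span_of_minimal_posRel [FiniteDimensional ℝ E] {L : Submodule ℝ E}
    {D : Finset E} (hD : Minimal (PosRel L) D) :
    Module.finrank ℝ ↥(L ⊔ Submodule.span ℝ (D : Set E)) + 1 = Module.finrank ℝ L + D.card := by
  classical
  obtain ⟨⟨v, hv⟩, c, hc, hcL⟩ := hD.prop
  have key : ∀ a : E → ℝ, ∑ u ∈ D.erase v, a u • u ∈ L → ∀ u ∈ D.erase v, a u = 0 := by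
    intro a ha
    have h0 : ∑ u ∈ D, (if u = v then 0 else a u) • u ∈ L := by
      rw [← Finset.add_sum_erase _ _ hv, if_pos rfl, zero_smul, zero_add]
      convert ha using 1
      exact Finset.sum_congr rfl fun u hu => by rw [if_neg (Finset.ne_of_mem_erase hu)]
    obtain ⟨r, hr⟩ := eq_mul_of_minimal_posRel hD hc hcL h0
    have hr0 : r = 0 := by
      have := hr v hv
      rw [if_pos rfl] at this
      exact (mul_eq_zero.1 this.symm).resolve_right (hc v hv).ne'
    intro u hu
    have := hr u (Finset.mem_of_mem_erase hu)
    rwa [if_neg (Finset.ne_of_mem_erase hu), hr0, zero_mul] at this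
  have hli : LinearIndepOn ℝ id ((D.erase v : Finset E) : Set E) :=
    linearIndepOn_finset_iff.2 fun a ha u hu => key a (by simp only [id] at ha; simp [ha]) u hu
  have hdisj : L ⊓ Submodule.span ℝ ((D.erase v : Finset E) : Set E) = ⊥ := by
    rw [← disjoint_iff, Submodule.disjoint_def]
    intro x hxL hx
    obtain ⟨a, -, rfl⟩ := Submodule.mem_span_finset.1 hx
    exact Finset.sum_eq_zero fun u hu => by rw [key a hxL u hu, zero_smul]
  have hsup : L ⊔ Submodule.span ℝ (D : Set E) =
      L ⊔ Submodule.span ℝ ((D.erase v : Finset E) : Set E) := by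
    apply le_antisymm
    · refine sup_le le_sup_left (Submodule.span_le.2 fun u hu => ?_)
      by_cases huv : u = v
      · subst huv
        have h1 : c u • u ∈ L ⊔ Submodule.span ℝ ((D.erase u : Finset E) : Set E) := by
          rw [← Finset.add_sum_erase _ _ hv] at hcL
          rw [← add_sub_cancel_right (c u • u) (∑ w ∈ D.erase u, c w • w)]
          refine Submodule.sub_mem _ (Submodule.mem_sup_left hcL) (Submodule.mem_sup_right ?_)
          exact Submodule.sum_mem _ fun w hw => Submodule.smul_mem _ _ (Submodule.subset_span hw)
        exact (Submodule.smul_mem_iff _ (hc u hv).ne').1 h1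
      · exact Submodule.mem_sup_right (Submodule.subset_span (Finset.mem_erase.2 ⟨huv, hu⟩))
    · exact sup_le_sup_left (Submodule.span_mono (by simp)) _
  have h1 := Submodule.finrank_sup_add_finrank_inf_eq L
    (Submodule.span ℝ ((D.erase v : Finset E) : Set E))
  rw [hdisj, finrank_bot, finrank_span_finset_eq_card hli, Finset.card_erase_of_mem hv,
    ← hsup] at h1
  have := Finset.card_pos.2 ⟨v, hv⟩
  omega

theorem affineIndependent_of_minimal_posRel {C : Finset E} (hC : Minimal (PosRel ⊥) C) :
    AffineIndependent ℝ ((↑) : C → E) := by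
  classical
  obtain ⟨⟨v, hv⟩, c, hc, hcL⟩ := hC.prop
  rw [affineIndependent_iff]
  intro s w hw0 hw i hi
  let a : E → ℝ := fun x => if h : x ∈ C then (if (⟨x, h⟩ : C) ∈ s then w ⟨x, h⟩ else 0) else 0
  obtain ⟨r, hr⟩ := eq_mul_of_minimal_posRel hC hc hcL (a := a)
    (by rw [Submodule.mem_bot, sum_dite_smul (fun x => x), hw])
  have h1 : ∑ x ∈ C, a x = 0 := by
    have := sum_dite_smul (s := s) (w := w) (fun _ => (1 : ℝ))
    simpa [hw0, a] using this
  have h2 : r * ∑ x ∈ C, c x = 0 := by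
    rw [Finset.mul_sum, ← h1]
    exact Finset.sum_congr rfl fun x hx => (hr x hx).symm
  have h3 : r = 0 := (mul_eq_zero.1 h2).resolve_right (Finset.sum_pos hc ⟨v, hv⟩).ne'
  have := hr i i.2
  rw [h3, zero_mul] at this
  simpa [a, hi] using this

/-- Lifting a positively dependent set modulo the span of `W` to an honest positive relation. -/
theorem posRel_bot_union [DecidableEq E] {W D : Finset E}
    (hW : ∀ v ∈ W, -v ∈ Submodule.span NNReal (W : Set E)) (hWD : Disjoint W D)
    (hD : PosRel (Submodule.span ℝ (W : Set E)) D) : PosRel ⊥ (W ∪ D) := by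
  obtain ⟨hne, c, hc, hcL⟩ := hD
  have h1 : -(∑ v ∈ D, c v • v) - ∑ v ∈ W, v ∈ Submodule.span ℝ (W : Set E) :=
    Submodule.sub_mem _ (Submodule.neg_mem _ hcL)
      (Submodule.sum_mem _ fun v hv => Submodule.subset_span hv)
  obtain ⟨b, hb, hbs⟩ := mem_nnspan_finset.1 (mem_nnspan_of_mem_span hW h1)
  refine ⟨hne.mono Finset.subset_union_right, fun v => if v ∈ W then b v + 1 else c v, ?_, ?_⟩
  · intro v hv
    dsimp only
    split_ifs with h
    · linarith [hb v]
    · exact hc v ((Finset.mem_union.1 hv).resolve_left h)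
  · rw [Submodule.mem_bot, Finset.sum_union hWD]
    have e1 : ∑ v ∈ W, (if v ∈ W then b v + 1 else c v) • v = ∑ v ∈ W, b v • v + ∑ v ∈ W, v := by
      rw [← Finset.sum_add_distrib]
      exact Finset.sum_congr rfl fun v hv => by rw [if_pos hv, add_smul, one_smul]
    have e2 : ∑ v ∈ D, (if v ∈ W then b v + 1 else c v) • v = ∑ v ∈ D, c v • v :=
      Finset.sum_congr rfl fun v hv => by rw [if_neg (Finset.disjoint_right.1 hWD hv)]
    rw [e1, e2, hbs]
    abel

theorem PosRel.sdiff [DecidableEq E] {W C : Finset E} (hC : PosRel ⊥ C) (hne : (C \ W).Nonempty) :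
    PosRel (Submodule.span ℝ (W : Set E)) (C \ W) := by
  obtain ⟨-, c, hc, hcL⟩ := hC
  refine ⟨hne, c, fun v hv => hc v (Finset.mem_sdiff.1 hv).1, ?_⟩
  rw [Submodule.mem_bot, ← Finset.sum_inter_add_sum_sdiff C W] at hcL
  rw [eq_neg_of_add_eq_zero_right hcL]
  exact Submodule.neg_mem _ (Submodule.sum_mem _ fun v hv =>
    Submodule.smul_mem _ _ (Submodule.subset_span (Finset.mem_inter.1 hv).2))

theorem exists_circuit_sdiff_eq [DecidableEq E] {W D : Finset E}
    (hW : ∀ v ∈ W, -v ∈ Submodule.span NNReal (W : Set E)) (hWD : Disjoint W D)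
    (hD : Minimal (PosRel (Submodule.span ℝ (W : Set E))) D) :
    ∃ C ⊆ W ∪ D, C \ W = D ∧ Minimal (PosRel ⊥) C := by
  obtain ⟨C, hCle, hC⟩ := exists_minimal_le_of_wellFoundedLT
    (fun C : Finset E => C \ W = D ∧ PosRel ⊥ C) (W ∪ D)
    ⟨by rw [Finset.union_sdiff_left, hWD.symm.sdiff_eq_left], posRel_bot_union hW hWD hD.prop⟩
  refine ⟨C, hCle, hC.prop.1, hC.prop.2, fun C' hC' hle => ?_⟩
  by_cases hne : (C' \ W).Nonempty
  · refine hC.2 ⟨?_, hC'⟩ hle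
    have hsub : C' \ W ⊆ D := hC.prop.1 ▸ Finset.sdiff_subset_sdiff hle subset_rfl
    exact le_antisymm hsub (hD.2 (hC'.sdiff hne) hsub)
  · exfalso
    have hC'W : C' ⊆ W := Finset.sdiff_eq_empty_iff_subset.1 (Finset.not_nonempty_iff_eq_empty.1 hne)
    obtain ⟨hCD, hCne, c, hc, hcL⟩ := hC.prop
    obtain ⟨hne', c', hc', hcL'⟩ := hC'
    obtain ⟨w, hw, hmin⟩ := C'.exists_min_image (fun v => c v / c' v) hne'
    set r := c w / c' w with hr
    have hrpos : 0 < r := div_pos (hc w (hle hw)) (hc' w hw)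
    let b : E → ℝ := fun v => c v - if v ∈ C' then r * c' v else 0
    have hbw : b w = 0 := by
      simp only [b, if_pos hw, hr, div_mul_cancel₀ _ (hc' w hw).ne', sub_self]
    have hb : ∀ v ∈ C, 0 ≤ b v := by
      intro v hv
      by_cases h : v ∈ C'
      · simp only [b, if_pos h]
        have := (le_div_iff₀ (hc' v h)).1 (hmin v h)
        linarith
      · simp only [b, if_neg h, sub_zero]
        exact (hc v hv).le
    have hsub : C.filter (fun v => 0 < b v) ⊆ C := Finset.filter_subset _ _
    have hDsub : ∀ v ∈ D, v ∈ C.filter (fun v => 0 < b v) := by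
      intro v hv
      have hv' := hv
      rw [← hCD, Finset.mem_sdiff] at hv'
      refine Finset.mem_filter.2 ⟨hv'.1, ?_⟩
      simp only [b, if_neg (fun h => hv'.2 (hC'W h)), sub_zero]
      exact hc v hv'.1
    have hQ : C.filter (fun v => 0 < b v) \ W = D ∧ PosRel ⊥ (C.filter fun v => 0 < b v) := by
      refine ⟨le_antisymm ?_ ?_, ?_, b, fun v hv => (Finset.mem_filter.1 hv).2, ?_⟩
      · exact hCD ▸ Finset.sdiff_subset_sdiff hsub subset_rfl
      · exact fun v hv => Finset.mem_sdiff.2 ⟨hDsub v hv, Finset.disjoint_right.1 hWD hv⟩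
      · obtain ⟨v, hv⟩ := hD.prop.1
        exact ⟨v, hDsub v hv⟩
      · rw [Finset.sum_subset hsub]
        · simp only [b, sub_smul, Finset.sum_sub_distrib]
          rw [Submodule.mem_bot] at hcL hcL' ⊢
          rw [hcL, zero_sub, neg_eq_zero]
          simp only [ite_smul, zero_smul]
          rw [← Finset.sum_filter, Finset.filter_mem_eq_inter, Finset.inter_eq_right.2 hle]
          simp only [mul_smul, ← Finset.smul_sum, hcL', smul_zero]
        · intro v hv hv'
          rw [le_antisymm (not_lt.1 fun h => hv' (Finset.mem_filter.2 ⟨hv, h⟩)) (hb v hv),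
            zero_smul]
    have := (Finset.mem_filter.1 (hC.2 hQ hsub (hle hw))).2
    exact this.ne' hbw

/-- A minimal positively spanning finite set, also called a positive basis. -/
structure IsPosBasis (V : Finset E) : Prop where
  span_eq_top : Submodule.span NNReal (V : Set E) = ⊤
  notMem : ∀ v ∈ V, v ∉ Submodule.span NNReal ((V : Set E) \ {v})

theorem IsPosBasis.exists_minimal_posRel {V : Finset E} (hV : IsPosBasis V) [DecidableEq E]
    {W : Finset E} (hWV : W ⊂ V) (hW : ∀ v ∈ W, -v ∈ Submodule.span NNReal (W : Set E)) :
    ∃ D ⊆ V \ W, 2 ≤ D.card ∧ Minimal (PosRel (Submodule.span ℝ (W : Set E))) D := by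
  obtain ⟨v, hvV, hvW⟩ := Finset.exists_of_ssubset hWV
  obtain ⟨b, hb, hbv⟩ := mem_nnspan_finset.1
    (show -v ∈ Submodule.span NNReal (V : Set E) by rw [hV.span_eq_top]; trivial)
  let a : E → ℝ := fun u => b u + if u = v then 1 else 0
  have ha : ∀ u, 0 ≤ a u := fun u => by
    dsimp only [a]
    split_ifs <;> linarith [hb u]
  have hsum : ∑ u ∈ V, a u • u = 0 := by
    simp only [a, add_smul, Finset.sum_add_distrib, hbv, ite_smul, zero_smul, one_smul,
      Finset.sum_ite_eq', if_pos hvV, neg_add_cancel]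
  have hne : v ∈ (V \ W).filter (fun u => 0 < a u) :=
    Finset.mem_filter.2 ⟨Finset.mem_sdiff.2 ⟨hvV, hvW⟩, by simp [a]; linarith [hb v]⟩
  have hrel : PosRel (Submodule.span ℝ (W : Set E)) ((V \ W).filter fun u => 0 < a u) := by
    refine ⟨⟨v, hne⟩, a, fun u hu => (Finset.mem_filter.1 hu).2, ?_⟩
    rw [Finset.sum_subset (Finset.filter_subset _ _)]
    · rw [← Finset.sum_sdiff hWV.1] at hsum
      rw [eq_neg_of_add_eq_zero_left hsum]
      exact Submodule.neg_mem _ (Submodule.sum_mem _ fun u hu =>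
        Submodule.smul_mem _ _ (Submodule.subset_span hu))
    · intro u hu hu'
      rw [le_antisymm (not_lt.1 fun h => hu' (Finset.mem_filter.2 ⟨hu, h⟩)) (ha u), zero_smul]
  obtain ⟨D, hDle, hD⟩ := exists_minimal_le_of_wellFoundedLT _ _ hrel
  have hDV : D ⊆ V \ W := hDle.trans (Finset.filter_subset _ _)
  refine ⟨D, hDV, ?_, hD⟩
  by_contra hcard
  have h1 : D.card = 1 := by
    have := Finset.card_pos.2 hD.prop.1
    omega
  obtain ⟨u, rfl⟩ := Finset.card_eq_one.1 h1
  obtain ⟨-, c, hc, hcL⟩ := hD.prop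
  rw [Finset.sum_singleton, Submodule.smul_mem_iff _ (hc u (by simp)).ne'] at hcL
  have huV := Finset.mem_sdiff.1 (hDV (Finset.mem_singleton_self u))
  refine hV.notMem u huV.1 (Submodule.span_mono ?_ (mem_nnspan_of_mem_span hW hcL))
  exact fun w hw => ⟨hWV.1 hw, fun h => huV.2 (h ▸ hw)⟩

theorem finrank_span_union [FiniteDimensional ℝ E] [DecidableEq E] {W D : Finset E}
    (hD : Minimal (PosRel (Submodule.span ℝ (W : Set E))) D) :
    Module.finrank ℝ (Submodule.span ℝ ((W ∪ D : Finset E) : Set E)) + 1 =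
      Module.finrank ℝ (Submodule.span ℝ (W : Set E)) + D.card := by
  rw [← finrank_sup_span_of_minimal_posRel hD, Finset.coe_union, Submodule.span_union]

theorem finrank_span_circuit [FiniteDimensional ℝ E] {C : Finset E}
    (hC : Minimal (PosRel ⊥) C) :
    Module.finrank ℝ (Submodule.span ℝ (C : Set E)) + 1 = C.card := by
  have h := finrank_sup_span_of_minimal_posRel hC
  rwa [bot_sup_eq, finrank_bot, zero_add] at h

/-- A positive basis has at most twice as many elements as the dimension, relative version. -/
theorem IsPosBasis.card_add_le [FiniteDimensional ℝ E] {V : Finset E} (hV : IsPosBasis V)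
    {W : Finset E} (hWV : W ⊆ V) (hW : ∀ v ∈ W, -v ∈ Submodule.span NNReal (W : Set E)) :
    V.card + 2 * Module.finrank ℝ (Submodule.span ℝ (W : Set E)) ≤
      W.card + 2 * Module.finrank ℝ E := by
  classical
  induction h : V.card - W.card using Nat.strong_induction_on generalizing W with
  | _ n ih =>
    rcases hWV.eq_or_ssubset with rfl | hss
    · have := Submodule.finrank_le (Submodule.span ℝ (W : Set E))
      omega
    · obtain ⟨D, hDV, hcard, hD⟩ := hV.exists_minimal_posRel hss hW
      have hdisj : Disjoint W D :=
        Finset.disjoint_right.2 fun v hv => (Finset.mem_sdiff.1 (hDV hv)).2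
      have hsub : W ∪ D ⊆ V := Finset.union_subset hWV (hDV.trans Finset.sdiff_subset)
      have hc := Finset.card_union_of_disjoint hdisj
      have h1 := Finset.card_le_card hsub
      have := ih (V.card - (W ∪ D).card) (by omega) hsub
        (fun v hv => (posRel_bot_union hW hdisj hD.prop).neg_mem_nnspan hv) rfl
      have := finrank_span_union hD
      omega

theorem IsPosBasis.card_add_card_circuit_le [FiniteDimensional ℝ E] {V C : Finset E}
    (hV : IsPosBasis V) (hCV : C ⊆ V) (hC : Minimal (PosRel ⊥) C) :
    V.card + C.card ≤ 2 * Module.finrank ℝ E + 2 := by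
  have h1 := hV.card_add_le hCV fun v hv => hC.prop.neg_mem_nnspan hv
  have h2 := finrank_span_circuit hC
  omega

/-- The first `t` members of `C` are circuits in `V`, each containing at least two elements not in
the union of its predecessors, and the dimension of the span of their union is `t` less than the
cardinality of that union. -/
structure IsCircuitChain [DecidableEq E] (V : Finset E) (t : ℕ) (C : ℕ → Finset E) : Prop where
  subset : ∀ i < t, C i ⊆ V
  minimal : ∀ i < t, Minimal (PosRel ⊥) (C i)
  card_inter : ∀ i < t, (C i ∩ (Finset.range i).biUnion C).card + 2 ≤ (C i).card
  neg_mem : ∀ v ∈ (Finset.range t).biUnion C,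
    -v ∈ Submodule.span NNReal (((Finset.range t).biUnion C : Finset E) : Set E)
  finrank : Module.finrank ℝ
    (Submodule.span ℝ (((Finset.range t).biUnion C : Finset E) : Set E)) + t =
      ((Finset.range t).biUnion C).card

theorem IsPosBasis.extend_circuitChain [FiniteDimensional ℝ E] [DecidableEq E] {V : Finset E}
    (hV : IsPosBasis V) {t : ℕ} {C : ℕ → Finset E} (hC : IsCircuitChain V t C)
    (hne : (Finset.range t).biUnion C ≠ V) : ∃ C', IsCircuitChain V (t + 1) C' := by
  set W := (Finset.range t).biUnion C with hWdef
  have hWV : W ⊂ V := lt_of_le_of_ne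
    (Finset.biUnion_subset.2 fun i hi => hC.subset i (Finset.mem_range.1 hi)) hne
  obtain ⟨D, hDV, hcard, hD⟩ := hV.exists_minimal_posRel hWV hC.neg_mem
  have hdisj : Disjoint W D :=
    Finset.disjoint_right.2 fun v hv => (Finset.mem_sdiff.1 (hDV hv)).2
  obtain ⟨A, hAsub, hAD, hA⟩ := exists_circuit_sdiff_eq hC.neg_mem hdisj hD
  have hW : ∀ i ≤ t, (Finset.range i).biUnion (Function.update C t A) =
      (Finset.range i).biUnion C := fun i hi =>
    Finset.biUnion_congr rfl fun j hj =>
      Function.update_of_ne (by have := Finset.mem_range.1 hj; omega) _ _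
  have hWs : (Finset.range (t + 1)).biUnion (Function.update C t A) = W ∪ D := by
    rw [Finset.range_add_one, Finset.biUnion_insert, Function.update_self, hW t le_rfl, ← hWdef,
      ← hAD]
    ext v
    simp only [Finset.mem_union, Finset.mem_sdiff]
    tauto
  have hlt : ∀ i < t + 1, i < t ∨ i = t := fun i hi => by omega
  have hAV : A ⊆ V := hAsub.trans
    (Finset.union_subset hWV.1 (hDV.trans Finset.sdiff_subset))
  refine ⟨Function.update C t A, fun i hi => ?_, fun i hi => ?_, fun i hi => ?_, ?_, ?_⟩
  · rcases hlt i hi with h | rfl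
    · rw [Function.update_of_ne h.ne]
      exact hC.subset i h
    · rwa [Function.update_self]
  · rcases hlt i hi with h | rfl
    · rw [Function.update_of_ne h.ne]
      exact hC.minimal i h
    · rwa [Function.update_self]
  · rw [hW i (by omega)]
    rcases hlt i hi with h | rfl
    · rw [Function.update_of_ne h.ne]
      exact hC.card_inter i h
    · rw [Function.update_self, ← hWdef]
      have := Finset.card_inter_add_card_sdiff A W
      rw [hAD] at this
      omega
  · rw [hWs]
    exact fun v hv => (posRel_bot_union hC.neg_mem hdisj hD.prop).neg_mem_nnspan hv
  · rw [hWs]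
    have h1 := finrank_span_union hD
    have h2 := Finset.card_union_of_disjoint hdisj
    have h3 := hC.finrank
    rw [← hWdef] at h3
    omega

theorem IsPosBasis.exists_circuitChain [FiniteDimensional ℝ E] [DecidableEq E] {V : Finset E}
    (hV : IsPosBasis V) :
    ∃ t C, IsCircuitChain V t C ∧ (Finset.range t).biUnion C = V := by
  by_contra! hcon
  have h : ∀ n, ∃ C, IsCircuitChain V n C := by
    intro n
    induction n with
    | zero => exact ⟨fun _ => ∅, by simp, by simp, by simp, by simp,
        by rw [Finset.range_zero, Finset.biUnion_empty, Finset.coe_empty, Submodule.span_empty,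
          finrank_bot, Finset.card_empty]⟩
    | succ n ih =>
      obtain ⟨C, hC⟩ := ih
      exact hV.extend_circuitChain hC (hcon n C hC)
  obtain ⟨C, hC⟩ := h (V.card + 1)
  have h1 := hC.finrank
  have h2 := Finset.card_le_card
    (Finset.biUnion_subset.2 fun i hi => hC.subset i (Finset.mem_range.1 hi))
  omega

end PositiveRelations

section ConvexHull

variable {E : Type*} [AddCommGroup E] [Module ℝ E]

theorem convexHull_subset_nnspan (s : Set E) :
    convexHull ℝ s ⊆ (Submodule.span NNReal s : Set E) := by
  refine convexHull_min Submodule.subset_span fun x hx y hy a b ha hb _ => ?_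
  exact add_mem (smul_mem_nnspan ha hx) (smul_mem_nnspan hb hy)

theorem convexHull_subset_span (s : Set E) : convexHull ℝ s ⊆ (Submodule.span ℝ s : Set E) :=
  convexHull_min Submodule.subset_span (Submodule.span ℝ s).convex

/-- A nonzero element of the cone over `s` can be rescaled into the convex hull of `s`. -/
theorem eq_zero_or_exists_smul_mem_convexHull {s : Set E} {x : E}
    (hx : x ∈ Submodule.span NNReal s) : x = 0 ∨ ∃ r : ℝ, 0 < r ∧ r • x ∈ convexHull ℝ s := by
  induction hx using Submodule.span_induction with
  | mem v hv => exact Or.inr ⟨1, one_pos, by simpa using subset_convexHull ℝ s hv⟩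
  | zero => exact Or.inl rfl
  | add x y _ _ hx hy =>
    rcases hx with rfl | ⟨r, hr, hx⟩
    · simpa using hy
    rcases hy with rfl | ⟨q, hq, hy⟩
    · exact Or.inr ⟨r, hr, by simpa using hx⟩
    refine Or.inr ⟨r * q / (r + q), by positivity, ?_⟩
    have h := convex_convexHull ℝ s hx hy (a := q / (r + q)) (b := r / (r + q)) (by positivity)
      (by positivity) (by field_simp; ring)
    convert h using 1
    rw [smul_add, smul_smul, smul_smul]
    congr 2 <;> ring
  | smul a x _ hx =>
    rcases hx with rfl | ⟨r, hr, hx⟩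
    · exact Or.inl (smul_zero _)
    rcases eq_or_lt_of_le (zero_le : 0 ≤ a) with rfl | ha
    · exact Or.inl (zero_smul _ _)
    have ha' : (0 : ℝ) < a := ha
    refine Or.inr ⟨r / a, by positivity, ?_⟩
    rw [NNReal.smul_def, smul_smul, div_mul_cancel₀ _ ha'.ne']
    exact hx

theorem zero_mem_convexHull_of_neg_mem {s : Set E} (hne : s.Nonempty)
    (hs : ∀ v ∈ s, -v ∈ Submodule.span NNReal s) : (0 : E) ∈ convexHull ℝ s := by
  obtain ⟨v, hv⟩ := hne
  have hv' := subset_convexHull ℝ s hv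
  rcases eq_zero_or_exists_smul_mem_convexHull (hs v hv) with h | ⟨r, hr, h⟩
  · rwa [← neg_eq_zero.1 h]
  · have := convex_convexHull ℝ s hv' h (a := r / (1 + r)) (b := 1 / (1 + r)) (by positivity)
      (by positivity) (by field_simp; ring)
    convert this using 1
    rw [smul_neg, smul_neg, smul_smul, div_mul_eq_mul_div, one_mul, add_neg_cancel]

theorem convexHull_biUnion_convexHull {ι : Type*} (J : Set ι) (A : ι → Set E) :
    convexHull ℝ (⋃ j ∈ J, convexHull ℝ (A j)) = convexHull ℝ (⋃ j ∈ J, A j) := by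
  apply subset_antisymm
  · refine convexHull_min (iUnion₂_subset fun j hj => ?_) (convex_convexHull ℝ _)
    exact convexHull_mono (subset_biUnion_of_mem (u := A) hj)
  · exact convexHull_mono (iUnion₂_mono fun j _ => subset_convexHull ℝ (A j))

theorem vectorSpan_convexHull (s : Set E) : vectorSpan ℝ (convexHull ℝ s) = vectorSpan ℝ s := by
  rw [← direction_affineSpan, affineSpan_convexHull, direction_affineSpan]

theorem extremePoints_convexHull_of_subset {P s : Set E} (hP : Convex ℝ P)
    (hs : s ⊆ P.extremePoints ℝ) : (convexHull ℝ s).extremePoints ℝ = s := by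
  refine subset_antisymm extremePoints_convexHull_subset fun v hv => ?_
  exact inter_extremePoints_subset_extremePoints_of_subset
    (convexHull_min (hs.trans extremePoints_subset) hP) ⟨subset_convexHull ℝ s hv, hs hv⟩

end ConvexHull

section IntrinsicInterior

variable {E : Type*} [NormedAddCommGroup E] [NormedSpace ℝ E]

theorem mem_intrinsicInterior_iff_mem_nhdsWithin {s : Set E} {x : E} :
    x ∈ intrinsicInterior ℝ s ↔
      x ∈ affineSpan ℝ s ∧ s ∈ nhdsWithin x (affineSpan ℝ s : Set E) := by
  rw [mem_intrinsicInterior]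
  constructor
  · rintro ⟨y, hy, rfl⟩
    exact ⟨y.2, preimage_coe_mem_nhds_subtype.1 (mem_interior_iff_mem_nhds.1 hy)⟩
  · rintro ⟨hx, h⟩
    exact ⟨⟨x, hx⟩, mem_interior_iff_mem_nhds.2 (preimage_coe_mem_nhds_subtype.2 h), rfl⟩

theorem exists_lineMap_mem_of_mem_intrinsicInterior {s : Set E} {x y : E}
    (hx : x ∈ intrinsicInterior ℝ s) (hy : y ∈ affineSpan ℝ s) :
    ∃ r : ℝ, 0 < r ∧ AffineMap.lineMap x y r ∈ s := by
  obtain ⟨hx', hs⟩ := mem_intrinsicInterior_iff_mem_nhdsWithin.1 hx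
  have ht : Filter.Tendsto (fun r : ℝ => AffineMap.lineMap x y r) (nhds 0)
      (nhdsWithin x (affineSpan ℝ s : Set E)) := by
    refine tendsto_nhdsWithin_iff.2 ⟨?_, Filter.Eventually.of_forall fun r =>
      AffineMap.lineMap_mem r hx' hy⟩
    have : Continuous fun r : ℝ => AffineMap.lineMap x y r := AffineMap.lineMap_continuous
    simpa using this.tendsto 0
  obtain ⟨r, hr, hr0⟩ := (((ht.eventually hs).filter_mono nhdsWithin_le_nhds).and
    (self_mem_nhdsWithin (s := Ioi (0 : ℝ)))).exists
  exact ⟨r, hr0, hr⟩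

theorem Convex.lineMap_mem_intrinsicInterior {s : Set E} (hs : Convex ℝ s) {y z : E}
    (hy : y ∈ intrinsicInterior ℝ s) (hz : z ∈ s) {r : ℝ} (hr : 0 < r) (hr1 : r ≤ 1) :
    AffineMap.lineMap z y r ∈ intrinsicInterior ℝ s := by
  obtain ⟨hy', hys⟩ := mem_intrinsicInterior_iff_mem_nhdsWithin.1 hy
  have hz' := subset_affineSpan ℝ s hz
  rw [mem_intrinsicInterior_iff_mem_nhdsWithin]
  refine ⟨AffineMap.lineMap_mem r hz' hy', ?_⟩
  have hinv : ∀ q p : ℝ, q * p = 1 → ∀ x : E,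
      AffineMap.lineMap z (AffineMap.lineMap z x p) q = x := by
    intro q p hqp x
    rw [AffineMap.lineMap_apply_module', AffineMap.lineMap_apply_module', add_sub_cancel_right,
      smul_smul, hqp, one_smul, sub_add_cancel]
  have hcont : Continuous fun x : E => AffineMap.lineMap z x r⁻¹ := by
    simp only [AffineMap.lineMap_apply_module']
    fun_prop
  have ht : Filter.Tendsto (fun x : E => AffineMap.lineMap z x r⁻¹)
      (nhdsWithin (AffineMap.lineMap z y r) (affineSpan ℝ s : Set E))
      (nhdsWithin y (affineSpan ℝ s : Set E)) := by
    refine tendsto_nhdsWithin_iff.2 ⟨?_, ?_⟩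
    · have := hcont.tendsto (AffineMap.lineMap z y r)
      rw [hinv _ _ (inv_mul_cancel₀ hr.ne')] at this
      exact this.mono_left nhdsWithin_le_nhds
    · filter_upwards [self_mem_nhdsWithin] with x hx
      exact AffineMap.lineMap_mem _ hz' hx
  filter_upwards [ht hys] with x hx
  rw [← hinv r r⁻¹ (mul_inv_cancel₀ hr.ne') x]
  exact hs.lineMap_mem hz hx ⟨hr.le, hr1⟩

theorem zero_mem_intrinsicInterior_convexHull [FiniteDimensional ℝ E] {s : Set E}
    (hne : s.Nonempty) (hs : ∀ v ∈ s, -v ∈ Submodule.span NNReal s) :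
    (0 : E) ∈ intrinsicInterior ℝ (convexHull ℝ s) := by
  have hconv := convex_convexHull ℝ s
  obtain ⟨y, hy⟩ := (hne.convexHull (𝕜 := ℝ)).intrinsicInterior hconv
  have hy' : -y ∈ Submodule.span NNReal s := mem_nnspan_of_mem_span hs
    (Submodule.neg_mem _ (convexHull_subset_span s (intrinsicInterior_subset hy)))
  rcases eq_zero_or_exists_smul_mem_convexHull hy' with h | ⟨r, hr, h⟩
  · rwa [← neg_eq_zero.1 h]
  · have := hconv.lineMap_mem_intrinsicInterior hy h (r := r / (1 + r)) (by positivity)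
      ((div_le_one (by positivity)).2 (by linarith))
    convert this using 1
    rw [AffineMap.lineMap_apply_module, smul_smul, smul_neg, ← sub_eq_neg_add, ← sub_smul]
    have : r / (1 + r) - (1 - r / (1 + r)) * r = 0 := by
      field_simp
      ring
    rw [this, zero_smul]

theorem zero_mem_interior_convexHull [FiniteDimensional ℝ E] [Nontrivial E] {s : Set E}
    (hs : Submodule.span NNReal s = ⊤) : (0 : E) ∈ interior (convexHull ℝ s) := by
  have hne : s.Nonempty := by
    rw [nonempty_iff_ne_empty]
    rintro rfl
    rw [Submodule.span_empty] at hs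
    obtain ⟨x, hx⟩ := exists_ne (0 : E)
    exact hx ((Submodule.mem_bot NNReal).1 (hs ▸ Submodule.mem_top))
  have hneg : ∀ v ∈ s, -v ∈ Submodule.span NNReal s := fun v _ => hs ▸ Submodule.mem_top
  have h0 := zero_mem_convexHull_of_neg_mem hne hneg
  have htop : (affineSpan ℝ (convexHull ℝ s) : Set E) = univ := by
    refine eq_univ_of_forall fun x => ?_
    have h0' := subset_affineSpan ℝ _ h0
    rcases eq_zero_or_exists_smul_mem_convexHull (s := s) (x := x) (hs ▸ Submodule.mem_top) with
      rfl | ⟨r, hr, h⟩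
    · exact h0'
    · have := AffineMap.lineMap_mem r⁻¹ h0' (subset_affineSpan ℝ _ h)
      rwa [AffineMap.lineMap_apply_module, smul_zero, zero_add, smul_smul,
        inv_mul_cancel₀ hr.ne', one_smul] at this
  have := (mem_intrinsicInterior_iff_mem_nhdsWithin.1
    (zero_mem_intrinsicInterior_convexHull hne hneg)).2
  rwa [htop, nhdsWithin_univ, ← mem_interior_iff_mem_nhds] at this

theorem nnspan_eq_top_of_zero_mem_interior {s : Set E}
    (hs : (0 : E) ∈ interior (convexHull ℝ s)) : Submodule.span NNReal s = ⊤ := by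
  refine eq_top_iff.2 fun x _ => ?_
  obtain ⟨r, hr, h⟩ := exists_lineMap_mem_of_mem_intrinsicInterior (y := x)
    (interior_subset_intrinsicInterior (𝕜 := ℝ) hs) (by
      rw [affineSpan_convexHull, affineSpan_eq_top_of_nonempty_interior ⟨0, hs⟩]
      trivial)
  rw [AffineMap.lineMap_apply_module, smul_zero, zero_add] at h
  have := smul_mem_nnspan (inv_nonneg.2 hr.le) (convexHull_subset_nnspan s h)
  rwa [smul_smul, inv_mul_cancel₀ hr.ne', one_smul] at this

theorem Convex.intrinsicInterior_subset_interior {S P : Set E} (hP : Convex ℝ P) (hSP : S ⊆ P)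
    (h0S : (0 : E) ∈ S) (h0 : (0 : E) ∈ interior P) : intrinsicInterior ℝ S ⊆ interior P := by
  intro x hx
  have h0' := subset_affineSpan ℝ _ h0S
  have hx' := subset_affineSpan ℝ _ (intrinsicInterior_subset hx)
  obtain ⟨r, hr, h⟩ := exists_lineMap_mem_of_mem_intrinsicInterior hx
    (AffineMap.lineMap_mem (2 : ℝ) h0' hx')
  have h1 : (1 + r) • x ∈ P := by
    convert hSP h using 1
    simp only [AffineMap.lineMap_apply_module, smul_zero, zero_add, smul_smul, ← add_smul]
    congr 1
    ring
  refine hP.openSegment_interior_self_subset_interior h0 h1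
    ⟨r / (1 + r), 1 / (1 + r), by positivity, by positivity, by field_simp; ring, ?_⟩
  rw [smul_zero, zero_add, smul_smul, one_div, inv_mul_cancel₀ (by positivity), one_smul]

end IntrinsicInterior

section CanonicalFano

variable {d : ℕ} {P : Set (Fin d → ℝ)}

theorem IsLatticePolytope.finite_setOf_isLatticePt (hP : IsLatticePolytope P) :
    {x ∈ P | IsLatticePt x}.Finite := by
  obtain ⟨V, -, rfl⟩ := hP
  obtain ⟨R, hR⟩ := (V.finite_toSet.isCompact_convexHull ℝ).isBounded.exists_norm_le
  refine (Set.Finite.pi' (t := fun _ : Fin d => Set.image ((↑) : ℤ → ℝ) (Set.Icc (-⌈R⌉) ⌈R⌉))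
    fun _ => (Set.finite_Icc _ _).image _).subset ?_
  rintro x ⟨hxP, hx⟩ i
  obtain ⟨z, hz⟩ := hx i
  have h1 : |(z : ℝ)| ≤ R := by
    rw [← hz]
    exact (norm_le_pi_norm x i).trans (hR x hxP)
  have h2 : |(z : ℝ)| ≤ (⌈R⌉ : ℝ) := h1.trans (Int.le_ceil R)
  exact ⟨z, abs_le.1 (by exact_mod_cast h2), hz.symm⟩

theorem IsLatticePolytope.convexHull_extremePoints (hP : IsLatticePolytope P) :
    (P.extremePoints ℝ).Finite ∧ (∀ v ∈ P.extremePoints ℝ, IsLatticePt v) ∧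
      convexHull ℝ (P.extremePoints ℝ) = P := by
  obtain ⟨V, hV, rfl⟩ := hP
  have hfin : ((convexHull ℝ (V : Set (Fin d → ℝ))).extremePoints ℝ).Finite :=
    V.finite_toSet.subset extremePoints_convexHull_subset
  refine ⟨hfin, fun v hv => hV v (extremePoints_convexHull_subset hv), ?_⟩
  rw [← (hfin.isClosed_convexHull ℝ).closure_eq]
  exact closure_convexHull_extremePoints (V.finite_toSet.isCompact_convexHull ℝ)
    (convex_convexHull ℝ _)

theorem isLatticePolytope_convexHull_of_finite {s : Set (Fin d → ℝ)} (hs : s.Finite)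
    (h : ∀ v ∈ s, IsLatticePt v) : IsLatticePolytope (convexHull ℝ s) :=
  ⟨hs.toFinset, fun v hv => h v (hs.mem_toFinset.1 hv), by rw [hs.coe_toFinset]⟩

theorem IsCanonicalFano.zero_mem_interior (hP : IsCanonicalFano P) : (0 : Fin d → ℝ) ∈ interior P :=
  (hP.2.ge (mem_singleton 0)).1

theorem isLatticePt_zero : IsLatticePt (0 : Fin d → ℝ) := fun _ => ⟨0, by simp⟩

theorem IsCanonicalFano.convex (hP : IsCanonicalFano P) : Convex ℝ P := by
  obtain ⟨V, -, rfl⟩ := hP.1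
  exact convex_convexHull ℝ _

theorem IsCanonicalFano.nnspan_extremePoints (hP : IsCanonicalFano P) :
    Submodule.span NNReal (P.extremePoints ℝ) = ⊤ := by
  apply nnspan_eq_top_of_zero_mem_interior
  rw [hP.1.convexHull_extremePoints.2.2]
  exact hP.zero_mem_interior

/-- A vertex of a minimal canonical Fano polytope is not in the cone over the other lattice
points of the polytope. -/
theorem IsMinimalCanonicalFano.notMem_nnspan [NeZero d] (hP : IsMinimalCanonicalFano P)
    {v : Fin d → ℝ} (hv : v ∈ P.extremePoints ℝ) :
    v ∉ Submodule.span NNReal ({x ∈ P | IsLatticePt x} \ {v}) := by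
  intro hmem
  have hlat := hP.1.1.convexHull_extremePoints.2.1
  have htop : Submodule.span NNReal ({x ∈ P | IsLatticePt x} \ {v}) = ⊤ := by
    rw [eq_top_iff, ← hP.1.nnspan_extremePoints, Submodule.span_le]
    intro u hu
    by_cases huv : u = v
    · exact huv ▸ hmem
    · exact Submodule.subset_span ⟨⟨hu.1, hlat u hu⟩, huv⟩
  have hsub : convexHull ℝ ({x ∈ P | IsLatticePt x} \ {v}) ⊆ P :=
    convexHull_min (fun x hx => hx.1.1) hP.1.convex
  refine hP.2 v hv ⟨isLatticePolytope_convexHull_of_finite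
    (hP.1.1.finite_setOf_isLatticePt.subset sdiff_subset) fun x hx => hx.1.2, ?_⟩
  refine subset_antisymm (fun x hx => ?_) ?_
  · exact hP.1.2.le ⟨interior_mono hsub hx.1, hx.2⟩
  · rintro _ rfl
    exact ⟨zero_mem_interior_convexHull htop, isLatticePt_zero⟩

theorem IsMinimalCanonicalFano.isPosBasis [NeZero d] (hP : IsMinimalCanonicalFano P)
    {V : Finset (Fin d → ℝ)} (hV : (V : Set (Fin d → ℝ)) = P.extremePoints ℝ) : IsPosBasis V where
  span_eq_top := by rw [hV, hP.1.nnspan_extremePoints]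
  notMem v hv h := by
    have hv' : v ∈ P.extremePoints ℝ := hV ▸ hv
    have hsub : (V : Set (Fin d → ℝ)) \ {v} ⊆ {x ∈ P | IsLatticePt x} \ {v} := by
      rw [hV]
      exact fun u hu => ⟨⟨hu.1.1, hP.1.1.convexHull_extremePoints.2.1 u hu.1⟩, hu.2⟩
    exact hP.notMem_nnspan hv' (Submodule.span_mono hsub h)

theorem isSimplexOfDim_convexHull {C : Finset (Fin d → ℝ)} {k : ℕ}
    (hC : Minimal (PosRel ⊥) C) (hk : C.card = k + 1) :
    IsSimplexOfDim k (convexHull ℝ (C : Set (Fin d → ℝ))) := by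
  refine ⟨fun i => (C.equivFinOfCardEq hk).symm i, ?_, ?_⟩
  · exact (affineIndependent_of_minimal_posRel hC).comp_embedding
      (C.equivFinOfCardEq hk).symm.toEmbedding
  · congr 1
    ext x
    constructor
    · exact fun hx => ⟨C.equivFinOfCardEq hk ⟨x, hx⟩, by simp⟩
    · rintro ⟨i, rfl⟩
      exact Subtype.prop _

/-- A positive circuit among the vertices of a minimal canonical Fano polytope spans a minimal
canonical Fano simplex. -/
theorem IsMinimalCanonicalFano.convexHull_circuit [NeZero d] (hP : IsMinimalCanonicalFano P)
    {C : Finset (Fin d → ℝ)} (hCP : (C : Set (Fin d → ℝ)) ⊆ P.extremePoints ℝ) {k : ℕ}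
    (hC : Minimal (PosRel ⊥) C) (hk : C.card = k + 1) :
    IsMinimalCanonicalFanoOfDim k (convexHull ℝ (C : Set (Fin d → ℝ))) := by
  have hneg : ∀ v ∈ (C : Set (Fin d → ℝ)), -v ∈ Submodule.span NNReal (C : Set (Fin d → ℝ)) :=
    fun v hv => hC.prop.neg_mem_nnspan hv
  have h0 := zero_mem_intrinsicInterior_convexHull (s := (C : Set (Fin d → ℝ))) hC.prop.1 hneg
  have h0S := intrinsicInterior_subset h0
  have hSP : convexHull ℝ (C : Set (Fin d → ℝ)) ⊆ P :=
    convexHull_min (hCP.trans extremePoints_subset) hP.1.convex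
  have hpoly : IsLatticePolytope (convexHull ℝ (C : Set (Fin d → ℝ))) :=
    ⟨C, fun v hv => hP.1.1.convexHull_extremePoints.2.1 v (hCP hv), rfl⟩
  have hrank : Module.finrank ℝ (vectorSpan ℝ (convexHull ℝ (C : Set (Fin d → ℝ)))) = k := by
    have hr : vectorSpan ℝ (range ((↑) : C → Fin d → ℝ)) = vectorSpan ℝ (C : Set (Fin d → ℝ)) :=
      congrArg _ Subtype.range_coe
    rw [vectorSpan_convexHull, ← hr]
    exact (affineIndependent_of_minimal_posRel hC).finrank_vectorSpan (by simpa using hk)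
  refine ⟨⟨hpoly, hrank, subset_antisymm (fun x hx => ?_) ?_⟩, fun v hv hcan => ?_⟩
  · exact hP.1.2.le ⟨hP.1.convex.intrinsicInterior_subset_interior hSP h0S
      hP.1.zero_mem_interior hx.1, hx.2⟩
  · rintro _ rfl
    exact ⟨h0, isLatticePt_zero⟩
  · have hvC := extremePoints_convexHull_subset hv
    have hvS := subset_convexHull ℝ _ hvC
    set T := convexHull ℝ ({x ∈ convexHull ℝ (C : Set (Fin d → ℝ)) | IsLatticePt x} \ {v}) with hT
    have hTS : T ⊆ convexHull ℝ (C : Set (Fin d → ℝ)) :=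
      convexHull_min (fun x hx => hx.1.1) (convex_convexHull ℝ _)
    have h0T : (0 : Fin d → ℝ) ∈ intrinsicInterior ℝ T := (hcan.2.2.ge (mem_singleton 0)).1
    have hspan : vectorSpan ℝ T = vectorSpan ℝ (convexHull ℝ (C : Set (Fin d → ℝ))) :=
      Submodule.eq_of_le_of_finrank_eq (vectorSpan_mono ℝ hTS) (hcan.2.1.trans hrank.symm)
    have hv' : v ∈ affineSpan ℝ T := by
      have h1 : v ∈ vectorSpan ℝ T := by
        rw [hspan]
        simpa using vsub_mem_vectorSpan ℝ hvS h0S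
      rw [← direction_affineSpan] at h1
      simpa using AffineSubspace.vadd_mem_of_mem_direction h1
        (subset_affineSpan ℝ _ (intrinsicInterior_subset h0T))
    obtain ⟨r, hr, h⟩ := exists_lineMap_mem_of_mem_intrinsicInterior h0T hv'
    rw [AffineMap.lineMap_apply_module, smul_zero, zero_add] at h
    have h2 := smul_mem_nnspan (inv_nonneg.2 hr.le) (convexHull_subset_nnspan _ h)
    rw [smul_smul, inv_mul_cancel₀ hr.ne', one_smul] at h2
    refine hP.notMem_nnspan (hCP hvC) (Submodule.span_mono ?_ h2)
    exact fun x hx => ⟨⟨hSP hx.1.1, hx.1.2⟩, hx.2⟩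

theorem isSimplexOfDim_zero_of_nonempty {P : Set (Fin 0 → ℝ)} (hP : P.Nonempty) :
    IsSimplexOfDim 0 P := by
  have : Subsingleton (Fin (0 + 1)) := inferInstanceAs (Subsingleton (Fin 1))
  refine ⟨fun _ => 0, affineIndependent_of_subsingleton ℝ _, ?_⟩
  rw [Set.range_const, convexHull_singleton]
  exact (subsingleton_of_subsingleton).eq_singleton_of_mem
    (by obtain ⟨x, hx⟩ := hP; rwa [Subsingleton.elim 0 x])

end CanonicalFano

/-- A minimal canonical Fano `d`-polytope `P` that is not a simplex
decomposes as `P = conv(S₁ ∪ ⋯ ∪ S_t)` for some `2 ≤ t ≤ d` and minimal canonical Fano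
simplices `Sᵢ` of dimensions `dᵢ ≥ 1` with `vert(Sᵢ) ⊆ vert(P)`, and setting
`rᵢ = |vert(Sᵢ) ∩ vert(conv(S₁ ∪ ⋯ ∪ S_{i-1}))|` (so `r₁ = 0`):
(1) `d₁ + ⋯ + d_t = d + (r₁ + ⋯ + r_t)`; (2) `rᵢ < dᵢ ≤ d - t + 1` for all `i`;
(3) `|vert(P)| = d + t`. -/
theorem minimal_decomposition (d : ℕ) (P : Set (Fin d → ℝ))
    (hP : IsMinimalCanonicalFano P) (hns : ¬ ∃ k, IsSimplexOfDim k P) :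
    ∃ t, 2 ≤ t ∧ t ≤ d ∧ ∃ (dvec : Fin t → ℕ) (S : Fin t → Set (Fin d → ℝ)),
      (∀ i, 1 ≤ dvec i ∧ IsSimplexOfDim (dvec i) (S i) ∧
        IsMinimalCanonicalFanoOfDim (dvec i) (S i) ∧
        Set.extremePoints ℝ (S i) ⊆ Set.extremePoints ℝ P) ∧
      P = convexHull ℝ (⋃ i, S i) ∧
      ∃ rvec : Fin t → ℕ,
        (∀ i, rvec i = (Set.extremePoints ℝ (S i) ∩
          Set.extremePoints ℝ (convexHull ℝ (⋃ j ∈ {j : Fin t | j < i}, S j))).ncard) ∧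
        (∑ i, dvec i = d + ∑ i, rvec i) ∧
        (∀ i, rvec i < dvec i ∧ dvec i ≤ d - t + 1) ∧
        (Set.extremePoints ℝ P).ncard = d + t := by
  classical
  rcases Nat.eq_zero_or_pos d with rfl | hd
  · exact absurd ⟨0, isSimplexOfDim_zero_of_nonempty
      ⟨0, interior_subset hP.1.zero_mem_interior⟩⟩ hns
  have : NeZero d := ⟨hd.ne'⟩
  obtain ⟨hfin, -, hconv⟩ := hP.1.1.convexHull_extremePoints
  obtain ⟨V, hV⟩ := hfin.exists_finset_coe
  have hbasis := hP.isPosBasis hV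
  obtain ⟨t, C, hC, hCV⟩ := hbasis.exists_circuitChain
  have hcard : V.card = d + t := by
    have h1 : Submodule.span ℝ (V : Set (Fin d → ℝ)) = ⊤ := by
      refine eq_top_iff.2 fun x _ => ?_
      have hx : x ∈ Submodule.span NNReal (V : Set (Fin d → ℝ)) :=
        hbasis.span_eq_top ▸ Submodule.mem_top
      exact Submodule.span_le_restrictScalars NNReal ℝ _ hx
    have h2 := hC.finrank
    rw [hCV, h1, finrank_top, Module.finrank_fin_fun] at h2
    exact h2.symm
  have hCP : ∀ i < t, (C i : Set (Fin d → ℝ)) ⊆ P.extremePoints ℝ := fun i hi =>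
    hV ▸ Finset.coe_subset.2 (hC.subset i hi)
  have hCk : ∀ i < t, (C i).card = (C i).card - 1 + 1 := fun i hi => by
    have := hC.card_inter i hi
    omega
  have hbound : ∀ i < t, (C i).card + t ≤ d + 2 := fun i hi => by
    have := hbasis.card_add_card_circuit_le (hC.subset i hi) (hC.minimal i hi)
    rw [Module.finrank_fin_fun] at this
    omega
  have ht2 : 2 ≤ t := by
    by_contra hlt
    obtain rfl | rfl : t = 0 ∨ t = 1 := by omega
    · rw [Finset.range_zero, Finset.biUnion_empty] at hCV
      rw [← hV, ← hCV, Finset.coe_empty, convexHull_empty] at hconv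
      have := interior_subset hP.1.zero_mem_interior
      rw [← hconv] at this
      exact this
    · have h1 : C 0 = V := by simpa using hCV
      refine hns ⟨V.card - 1, ?_⟩
      have := isSimplexOfDim_convexHull (hC.minimal 0 one_pos) (hCk 0 one_pos)
      rwa [h1, hV, hconv] at this
  have hinter : ∀ i : Fin t, (⋃ j ∈ {j : Fin t | j < i}, (C j : Set (Fin d → ℝ))) =
      ((Finset.range i).biUnion C : Finset (Fin d → ℝ)) := by
    intro i
    ext x
    simp only [mem_iUnion, mem_ofPred_eq, exists_prop, Finset.coe_biUnion, Finset.coe_range,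
      mem_Iio, Finset.mem_coe]
    exact ⟨fun ⟨j, hj, hx⟩ => ⟨j, hj, hx⟩, fun ⟨j, hj, hx⟩ => ⟨⟨j, hj.trans i.2⟩, hj, hx⟩⟩
  have hunion : ((Finset.range t).biUnion C : Set (Fin d → ℝ)) =
      ⋃ i ∈ (univ : Set (Fin t)), (C i : Set (Fin d → ℝ)) := by
    ext x
    simp only [mem_iUnion, mem_univ, exists_prop, true_and, Finset.coe_biUnion, Finset.coe_range,
      mem_Iio, Finset.mem_coe]
    exact ⟨fun ⟨j, hj, hx⟩ => ⟨⟨j, hj⟩, hx⟩, fun ⟨j, hx⟩ => ⟨j, j.2, hx⟩⟩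
  have hext : ∀ i < t, (convexHull ℝ (C i : Set (Fin d → ℝ))).extremePoints ℝ = C i := fun i hi =>
    extremePoints_convexHull_of_subset hP.1.convex (hCP i hi)
  refine ⟨t, ht2, ?_, fun i => (C i).card - 1, fun i => convexHull ℝ (C i : Set (Fin d → ℝ)),
    fun i => ⟨?_, isSimplexOfDim_convexHull (hC.minimal i i.2) (hCk i i.2),
      hP.convexHull_circuit (hCP i i.2) (hC.minimal i i.2) (hCk i i.2), ?_⟩, ?_,
    fun i => (C i ∩ (Finset.range i).biUnion C).card, fun i => ?_, ?_, fun i => ⟨?_, ?_⟩, ?_⟩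
  · have h1 := hbound 0 (by omega)
    have h2 := hC.card_inter 0 (by omega)
    omega
  · have := hC.card_inter i i.2
    dsimp only
    omega
  · rw [hext i i.2]
    exact hCP i i.2
  · rw [← biUnion_univ, convexHull_biUnion_convexHull, ← hunion, hCV, hV, hconv]
  · have hsub : (((Finset.range i).biUnion C : Finset (Fin d → ℝ)) : Set (Fin d → ℝ)) ⊆
        P.extremePoints ℝ := by
      rw [← hV, ← hCV]
      exact Finset.coe_subset.2 (Finset.biUnion_subset_biUnion_of_subset_left _
        (Finset.range_subset_range.2 i.2.le))
    rw [convexHull_biUnion_convexHull, hinter, hext i i.2,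
      extremePoints_convexHull_of_subset hP.1.convex hsub, ← Finset.coe_inter, ncard_coe_finset]
  · have h1 := sum_card_eq_card_biUnion_add C t
    have h2 : ∑ i ∈ Finset.range t, (C i).card = ∑ i ∈ Finset.range t, ((C i).card - 1) + t := by
      rw [Finset.sum_congr rfl fun i hi => hCk i (Finset.mem_range.1 hi), Finset.sum_add_distrib]
      simp
    rw [Fin.sum_univ_eq_sum_range (fun i => (C i).card - 1) t,
      Fin.sum_univ_eq_sum_range (fun i => (C i ∩ (Finset.range i).biUnion C).card) t]
    rw [hCV, hcard] at h1
    omega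
  · have := hC.card_inter i i.2
    dsimp only
    omega
  · have := hbound i i.2
    have := hC.card_inter i i.2
    dsimp only
    omega
  · rw [← hV, ncard_coe_finset, hcard]
end
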